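/- arXiv:1501.05398 — 6 statements merged into one kernel-verified Lean document; each statement's English description precedes it below -/
import Mathlib

section
/- Let n ≥ 5 be an odd integer. Then the bow-tie graph C_6 ⋈ P_n is 3-extendable. -/
open SimpleGraph

/-- A set of edges of `G` forming a matching: pairwise disjoint edges of `G`. -/
def IsMatchingSet {V : Type*} (G : SimpleGraph V) (M : Set (Sym2 V)) : Prop :=
  M ⊆ G.edgeSet ∧ M.Pairwise fun e f => ∀ v, v ∈ e → v ∉ f

/-- A perfect matching of `G`: a matching covering every vertex. -/
def IsPerfectMatchingSet {V : Type*} (G : SimpleGraph V) (M : Set (Sym2 V)) : Prop :=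
  IsMatchingSet G M ∧ ∀ v : V, ∃ e ∈ M, v ∈ e

/-- `G` is `k`-extendable: it has a perfect matching, and every `k`-matching
extends to a perfect matching. -/
def Extendable {V : Type*} (G : SimpleGraph V) (k : ℕ) : Prop :=
  (∃ P, IsPerfectMatchingSet G P) ∧
    ∀ M : Set (Sym2 V), IsMatchingSet G M → M.ncard = k →
      ∃ P, IsPerfectMatchingSet G P ∧ M ⊆ P

/-- The cycle graph on `n` vertices, with vertex set `ZMod n`. -/
def cycleZMod (n : ℕ) : SimpleGraph (ZMod n) :=
  SimpleGraph.fromRel fun a b => b = a + 1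

/-- The bow-tie graph `C₆ ⋈ P_n`: the Cartesian product `C₆ × P_n`
(rows indexed by `ZMod 6`, columns by `Fin n`, where column `j ∈ {1,…,n}` of the paper
corresponds to the `Fin n` element with value `j - 1`) together with the extra edges
`v_{i,1} v_{8−i,n}` (i.e. `v_{i,1} v_{2−i,n}` in `ZMod 6`) for all rows `i`. -/
def bowTie (n : ℕ) : SimpleGraph (ZMod 6 × Fin n) :=
  (cycleZMod 6 □ SimpleGraph.pathGraph n) ⊔
    SimpleGraph.fromRel fun p q => p.2.val = 0 ∧ q.2.val = n - 1 ∧ q.1 = 2 - p.1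

namespace BowTie

/-! ### Coordinates

A vertex is a pair `(column, row)`. An edge is a triple `(b, j, i)`: for `b = false` it is the edge
inside column `j` from row `i` to row `i + 1`, and for `b = true` the edge from row `i` of column
`j` to the next column, which for `j = n - 1` is column `0` with row `i` replaced by `2 - i`. -/

/-- The first endpoint of an edge. -/
def source (e : Bool × ℕ × ZMod 6) : ℕ × ZMod 6 := e.2

/-- The second endpoint of an edge. -/
def target (n : ℕ) : Bool × ℕ × ZMod 6 → ℕ × ZMod 6
  | (false, j, i) => (j, i + 1)
  | (true, j, i) => if j + 1 = n then (0, 2 - i) else (j + 1, i)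

/-- The neighbour of a vertex in the preceding column. -/
def prev (n : ℕ) (p : ℕ × ZMod 6) : ℕ × ZMod 6 :=
  if p.1 = 0 then (n - 1, 2 - p.2) else (p.1 - 1, p.2)

/-- Two edges without a common endpoint. -/
def Apart (n : ℕ) (e f : Bool × ℕ × ZMod 6) : Prop :=
  source e ≠ source f ∧ source e ≠ target n f ∧ target n e ≠ source f ∧ target n e ≠ target n f

lemma target_col_lt {n : ℕ} {e : Bool × ℕ × ZMod 6} (he : e.2.1 < n) : (target n e).1 < n := by
  obtain ⟨_ | _, j, i⟩ := e
  · exact he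
  · simp only [target]
    simp only at he
    split_ifs <;> simp only <;> omega

/-- Exactly one of four Booleans is true. -/
def exactlyOne (a b c d : Bool) : Bool :=
  bif a then !b && !c && !d else bif b then !c && !d else xor c d

/-- A set of edges of `C₆ ⋈ P_n` containing exactly one of the four edges at each vertex. -/
def IsDimer (n : ℕ) (D : Bool × ℕ × ZMod 6 → Bool) : Prop :=
  ∀ j < n, ∀ i, exactlyOne (D (true, j, i)) (D (true, prev n (j, i))) (D (false, j, i))
    (D (false, j, i - 1)) = true

/-- The three edges lie in a common perfect matching. -/
def Joinable (n : ℕ) (e f g : Bool × ℕ × ZMod 6) : Prop :=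
  ∃ D, IsDimer n D ∧ D e = true ∧ D f = true ∧ D g = true

/-! ### Passing to the graph -/

/-- The coordinates of a vertex. -/
def coord {n : ℕ} (v : ZMod 6 × Fin n) : ℕ × ZMod 6 := (v.2.val, v.1)

lemma coord_injective {n : ℕ} : Function.Injective (coord (n := n)) := by
  intro u v h
  simp only [coord, Prod.mk.injEq] at h
  exact Prod.ext h.2 (Fin.ext h.1)

lemma bowTie_adj_of_edge {n : ℕ} (hn : 3 ≤ n) {u v : ZMod 6 × Fin n} {e : Bool × ℕ × ZMod 6}
    (hu : source e = coord u) (hv : target n e = coord v) : (bowTie n).Adj u v := by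
  obtain ⟨a, b⟩ := u
  obtain ⟨c, d⟩ := v
  obtain ⟨_ | _, j, i⟩ := e
  · simp only [source, target, coord, Prod.mk.injEq] at hu hv
    obtain ⟨rfl, rfl⟩ := hu
    obtain ⟨h, rfl⟩ := hv
    left
    have h1 : (1 : ZMod 6) ≠ 0 := by decide
    simp [SimpleGraph.boxProd_adj, cycleZMod, Fin.ext_iff, h, h1]
  · simp only [source, coord, Prod.mk.injEq] at hu
    obtain ⟨rfl, rfl⟩ := hu
    simp only [target] at hv
    split_ifs at hv with hj
    · simp only [coord, Prod.mk.injEq] at hv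
      obtain ⟨h, rfl⟩ := hv
      right
      rw [SimpleGraph.fromRel_adj]
      refine ⟨?_, Or.inr ⟨h.symm, by simp; omega, by simp⟩⟩
      intro h'
      have := congrArg (fun p => p.2.val) h'
      simp at this
      omega
    · simp only [coord, Prod.mk.injEq] at hv
      obtain ⟨h, rfl⟩ := hv
      left
      simp [SimpleGraph.boxProd_adj, SimpleGraph.pathGraph_adj, h]

lemma exists_edge_of_bowTie_adj {n : ℕ} {u v : ZMod 6 × Fin n} (h : (bowTie n).Adj u v) :
    ∃ e, (source e = coord u ∧ target n e = coord v) ∨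
      (source e = coord v ∧ target n e = coord u) := by
  obtain ⟨a, b⟩ := u
  obtain ⟨c, d⟩ := v
  have hb := b.isLt
  have hd := d.isLt
  simp only [bowTie, SimpleGraph.sup_adj, SimpleGraph.boxProd_adj, SimpleGraph.pathGraph_adj,
    cycleZMod, SimpleGraph.fromRel_adj] at h
  rcases h with (⟨⟨-, rfl | rfl⟩, rfl⟩ | ⟨hbd | hbd, rfl⟩) | ⟨-, ⟨h1, h2, rfl⟩ | ⟨h1, h2, rfl⟩⟩
  · exact ⟨(false, b, a), .inl ⟨rfl, rfl⟩⟩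
  · exact ⟨(false, b, c), .inr ⟨rfl, rfl⟩⟩
  · refine ⟨(true, b, a), .inl ⟨rfl, ?_⟩⟩
    rw [target, if_neg (by omega)]
    simp [coord, hbd]
  · refine ⟨(true, d, a), .inr ⟨rfl, ?_⟩⟩
    rw [target, if_neg (by omega)]
    simp [coord, hbd]
  · refine ⟨(true, d, 2 - a), .inr ⟨rfl, ?_⟩⟩
    rw [target, if_pos (by omega)]
    simp [coord, h1]
  · refine ⟨(true, b, 2 - c), .inl ⟨rfl, ?_⟩⟩
    rw [target, if_pos (by omega)]
    simp [coord, h1]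

/-- The edges of the graph belonging to `D`. -/
def edgesOf (n : ℕ) (D : Bool × ℕ × ZMod 6 → Bool) : Set (Sym2 (ZMod 6 × Fin n)) :=
  {s | ∃ u v e, s = s(u, v) ∧ source e = coord u ∧ target n e = coord v ∧ D e = true}

/-- The edges at a vertex are the four that `IsDimer` refers to. -/
lemma eq_of_incident {n : ℕ} {p : ℕ × ZMod 6} {e : Bool × ℕ × ZMod 6} (he : e.2.1 < n)
    (h : source e = p ∨ target n e = p) :
    e = (true, p) ∨ e = (true, prev n p) ∨ e = (false, p) ∨ e = (false, p.1, p.2 - 1) := by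
  obtain ⟨b, j, i⟩ := e
  simp only at he
  rcases h with rfl | rfl
  · cases b <;> simp [source]
  · cases b
    · simp [target]
    · by_cases hj : j + 1 = n
      · subst hj
        simp [target, prev]
      · simp [target, prev, hj]

lemma incident_of_eq {n : ℕ} {p : ℕ × ZMod 6} {e : Bool × ℕ × ZMod 6} (hp : p.1 < n)
    (h : e = (true, p) ∨ e = (true, prev n p) ∨ e = (false, p) ∨ e = (false, p.1, p.2 - 1)) :
    source e = p ∨ target n e = p := by
  obtain ⟨j, i⟩ := p
  rcases h with rfl | rfl | rfl | rfl
  · exact .inl rfl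
  · right
    by_cases hj : j = 0
    · subst hj
      simp only at hp
      simp [prev, target, Nat.sub_add_cancel hp]
    · have h1 : j - 1 + 1 = j := by omega
      have h2 : j ≠ n := by simp only at hp; omega
      simp [prev, target, hj, h1, h2]
  · exact .inl rfl
  · simp [target]

lemma IsDimer.eq_of_incident {n : ℕ} {D : Bool × ℕ × ZMod 6 → Bool} (hD : IsDimer n D)
    {e f : Bool × ℕ × ZMod 6} {p : ℕ × ZMod 6} (hp : p.1 < n) (he : e.2.1 < n) (hf : f.2.1 < n)
    (h1 : source e = p ∨ target n e = p) (h2 : source f = p ∨ target n f = p)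
    (hDe : D e = true) (hDf : D f = true) : e = f := by
  have hx := hD p.1 hp p.2
  have h3 := BowTie.eq_of_incident he h1
  have h4 := BowTie.eq_of_incident hf h2
  unfold exactlyOne at hx
  rcases h3 with rfl | rfl | rfl | rfl <;> rcases h4 with rfl | rfl | rfl | rfl <;>
    simp_all

lemma isPerfectMatchingSet_edgesOf {n : ℕ} (hn : 3 ≤ n) {D : Bool × ℕ × ZMod 6 → Bool}
    (hD : IsDimer n D) : IsPerfectMatchingSet (bowTie n) (edgesOf n D) := by
  refine ⟨⟨?_, ?_⟩, ?_⟩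
  · rintro _ ⟨u, v, e, rfl, hu, hv, -⟩
    exact bowTie_adj_of_edge hn hu hv
  · rintro _ ⟨u, v, e, rfl, hu, hv, he⟩ _ ⟨u', v', e', rfl, hu', hv', he'⟩ hne w hw hw'
    refine hne ?_
    have hlt : ∀ (e : Bool × ℕ × ZMod 6) (u : ZMod 6 × Fin n), source e = coord u → e.2.1 < n :=
      fun e u h => by
        have : e.2.1 = u.2.val := congrArg Prod.fst h
        omega
    have h1 : source e = coord w ∨ target n e = coord w := by
      rw [hu, hv]
      rcases Sym2.mem_iff.1 hw with rfl | rfl <;> simp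
    have h2 : source e' = coord w ∨ target n e' = coord w := by
      rw [hu', hv']
      rcases Sym2.mem_iff.1 hw' with rfl | rfl <;> simp
    obtain rfl := hD.eq_of_incident w.2.isLt (hlt _ _ hu) (hlt _ _ hu') h1 h2 he he'
    rw [coord_injective (hu.symm.trans hu'), coord_injective (hv.symm.trans hv')]
  · intro w
    have hw := w.2.isLt
    have key : ∀ e, e.2.1 < n → (source e = coord w ∨ target n e = coord w) → D e = true →
        ∃ s ∈ edgesOf n D, w ∈ s := by
      intro e hlt he hDe
      obtain ⟨u, hu⟩ : ∃ u : ZMod 6 × Fin n, source e = coord u := ⟨(e.2.2, ⟨e.2.1, hlt⟩), rfl⟩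
      obtain ⟨v, hv⟩ : ∃ v : ZMod 6 × Fin n, target n e = coord v := by
        exact ⟨((target n e).2, ⟨(target n e).1, target_col_lt hlt⟩), rfl⟩
      refine ⟨s(u, v), ⟨u, v, e, rfl, hu, hv, hDe⟩, ?_⟩
      rw [hu, hv] at he
      rcases he with he | he <;> simp [coord_injective he]
    have hx := hD w.2.val hw w.1
    have hprev : (prev n (coord w)).1 < n := by
      unfold prev coord
      split_ifs <;> simp only <;> omega
    have k1 := key (true, coord w) hw (incident_of_eq hw (by simp))
    have k2 := key (true, prev n (coord w)) hprev (incident_of_eq hw (by simp))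
    have k3 := key (false, coord w) hw (incident_of_eq hw (by simp))
    have k4 := key (false, (coord w).1, (coord w).2 - 1) hw (incident_of_eq hw (by simp))
    by_contra hno
    simp only [hno, imp_false, Bool.not_eq_true, coord] at k1 k2 k3 k4
    simp [exactlyOne, k1, k2, k3, k4] at hx

lemma extendable_of_joinable {n : ℕ} (hn : 3 ≤ n)
    (H : ∀ e f g, e.2.1 < n → f.2.1 < n → g.2.1 < n → Apart n e f → Apart n e g → Apart n f g →
      Joinable n e f g) :
    Extendable (bowTie n) 3 := by
  refine ⟨⟨_, isPerfectMatchingSet_edgesOf hn (D := fun e => !e.1 && decide (e.2.2.val % 2 = 0))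
    fun j _ i => ?_⟩, ?_⟩
  · simp only [exactlyOne, Bool.not_true, Bool.false_and, Bool.not_false, Bool.true_and, cond_false]
    exact (by decide : ∀ i : ZMod 6, xor (decide (i.val % 2 = 0)) (decide ((i - 1).val % 2 = 0)) =
      true) i
  · intro M hM hcard
    obtain ⟨x, y, z, hxy, hxz, hyz, rfl⟩ := Set.ncard_eq_three.1 hcard
    have lift : ∀ s ∈ (bowTie n).edgeSet, ∃ u v e, s = s(u, v) ∧ source e = coord u ∧
        target n e = coord v := by
      intro s hs
      induction s with | _ u v
      obtain ⟨e, ⟨h1, h2⟩ | ⟨h1, h2⟩⟩ := exists_edge_of_bowTie_adj hs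
      · exact ⟨u, v, e, rfl, h1, h2⟩
      · exact ⟨v, u, e, Sym2.eq_swap, h1, h2⟩
    have hdisj : ∀ {u v u' v' : ZMod 6 × Fin n} {e e' : Bool × ℕ × ZMod 6},
        s(u, v) ∈ ({x, y, z} : Set _) → s(u', v') ∈ ({x, y, z} : Set _) → s(u, v) ≠ s(u', v') →
        source e = coord u → target n e = coord v → source e' = coord u' →
        target n e' = coord v' → Apart n e e' := by
      intro u v u' v' e e' h1 h2 hne hu hv hu' hv'
      have h3 := hM.2 h1 h2 hne
      have h4 := h3 u (Sym2.mem_mk_left u v)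
      have h5 := h3 v (Sym2.mem_mk_right u v)
      simp only [Sym2.mem_iff, not_or] at h4 h5
      simp only [Apart, hu, hv, hu', hv', ne_eq, coord_injective.eq_iff]
      exact ⟨h4.1, h4.2, h5.1, h5.2⟩
    obtain ⟨u, v, e, rfl, hu, hv⟩ := lift x (hM.1 (by simp))
    obtain ⟨u', v', e', rfl, hu', hv'⟩ := lift y (hM.1 (by simp))
    obtain ⟨u'', v'', e'', rfl, hu'', hv''⟩ := lift z (hM.1 (by simp))
    have hlt : ∀ (e : Bool × ℕ × ZMod 6) (u : ZMod 6 × Fin n), source e = coord u → e.2.1 < n :=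
      fun e u h => by
        have : e.2.1 = u.2.val := congrArg Prod.fst h
        omega
    obtain ⟨D, hD, h1, h2, h3⟩ := H e e' e'' (hlt _ _ hu) (hlt _ _ hu') (hlt _ _ hu'')
      (hdisj (by simp) (by simp) hxy hu hv hu' hv')
      (hdisj (by simp) (by simp) hxz hu hv hu'' hv'')
      (hdisj (by simp) (by simp) hyz hu' hv' hu'' hv'')
    refine ⟨_, isPerfectMatchingSet_edgesOf hn hD, ?_⟩
    rintro s (rfl | rfl | rfl)
    · exact ⟨u, v, e, rfl, hu, hv, h1⟩
    · exact ⟨u', v', e', rfl, hu', hv', h2⟩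
    · exact ⟨u'', v'', e'', rfl, hu'', hv'', h3⟩

/-! ### Rotation by one column -/

/-- The automorphism of the bow-tie graph that moves every column one step back, on edges. -/
def rotate (n : ℕ) : Bool × ℕ × ZMod 6 → Bool × ℕ × ZMod 6
  | (b, j, i) => if j = 0 then (b, n - 1, (bif b then 2 else 1) - i) else (b, j - 1, i)

lemma rotate_col_lt {n : ℕ} {e : Bool × ℕ × ZMod 6} (he : e.2.1 < n) : (rotate n e).2.1 < n := by
  obtain ⟨b, j, i⟩ := e
  simp only [rotate]
  simp only at he
  split_ifs <;> simp only <;> omega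

lemma IsDimer.comp_rotate {n : ℕ} (hn : 3 ≤ n) {D : Bool × ℕ × ZMod 6 → Bool} (hD : IsDimer n D) :
    IsDimer n (D ∘ rotate n) := by
  intro j hj i
  rcases j with _ | _ | j
  · have h := hD (n - 1) (by omega) (2 - i)
    have h1 : n - 1 ≠ 0 := by omega
    have h2 : (2 - i - 1 : ZMod 6) = 1 - i := by ring
    have h3 : (1 - (i - 1) : ZMod 6) = 2 - i := by ring
    simp only [exactlyOne, Function.comp_apply, rotate, prev, h1, h2, h3, if_true, if_false,
      cond_true, cond_false] at h ⊢
    revert h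
    cases D (false, n - 1, 2 - i) <;> cases D (false, n - 1, 1 - i) <;> simp
  · have h := hD 0 (by omega) i
    simpa [rotate, prev] using h
  · have h := hD (j + 1) (by omega) i
    simpa [rotate, prev] using h

lemma rotate_ends {n : ℕ} (hn : 2 ≤ n) {e : Bool × ℕ × ZMod 6} (he : e.2.1 < n) :
    source (rotate n e) = prev n (source e) ∧ target n (rotate n e) = prev n (target n e) ∨
      source (rotate n e) = prev n (target n e) ∧ target n (rotate n e) = prev n (source e) := by
  obtain ⟨b, j, i⟩ := e
  simp only at he
  rcases j with _ | j
  · have h1 : n - 1 + 1 = n := by omega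
    have h2 : (1 - i + 1 : ZMod 6) = 2 - i := by ring
    have h3 : (2 - (i + 1) : ZMod 6) = 1 - i := by ring
    have h4 : 1 ≠ n := by omega
    cases b
    · right
      simp [source, target, rotate, prev, h2, h3]
    · left
      simp [source, target, rotate, prev, h1, h4]
  · left
    cases b
    · simp [source, target, rotate, prev]
    · have h1 : j + 1 ≠ n := by omega
      by_cases h2 : j + 2 = n
      · have h3 : j + 1 = n - 1 := by omega
        simp [source, target, rotate, prev, h1, h2, ← h3]
      · simp [source, target, rotate, prev, h1, h2]

lemma prev_injOn (n : ℕ) : Set.InjOn (prev n) {p | p.1 < n} := by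
  rintro ⟨j, i⟩ hj ⟨j', i'⟩ hj' h
  simp only [Set.mem_ofPred_eq] at hj hj'
  simp only [prev] at h
  split_ifs at h with h1 h2 h2 <;> simp only [Prod.mk.injEq] at h ⊢
  · exact ⟨by omega, sub_right_injective h.2⟩
  · omega
  · omega
  · exact ⟨by omega, h.2⟩

lemma Apart.rotate {n : ℕ} (hn : 3 ≤ n) {e f : Bool × ℕ × ZMod 6} (he : e.2.1 < n) (hf : f.2.1 < n)
    (h : Apart n e f) : Apart n (rotate n e) (rotate n f) := by
  have hinj : ∀ {p q : ℕ × ZMod 6}, p.1 < n → q.1 < n → p ≠ q → prev n p ≠ prev n q :=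
    fun hp hq hne hpq => hne (prev_injOn n hp hq hpq)
  have he' := target_col_lt he
  have hf' := target_col_lt hf
  have h1 := hinj he hf h.1
  have h2 := hinj he hf' h.2.1
  have h3 := hinj he' hf h.2.2.1
  have h4 := hinj he' hf' h.2.2.2
  unfold Apart
  rcases rotate_ends (by omega) he with ⟨a, b⟩ | ⟨a, b⟩ <;>
    rcases rotate_ends (by omega) hf with ⟨c, d⟩ | ⟨c, d⟩ <;> rw [a, b, c, d]
  exacts [⟨h1, h2, h3, h4⟩, ⟨h2, h1, h4, h3⟩, ⟨h3, h4, h1, h2⟩, ⟨h4, h3, h2, h1⟩]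

/-- It suffices to consider triples whose first edge starts in column `0`. -/
lemma joinable_of_first_col_zero {n : ℕ} (hn : 3 ≤ n)
    (H : ∀ e f g, e.2.1 = 0 → f.2.1 < n → g.2.1 < n → Apart n e f → Apart n e g → Apart n f g →
      Joinable n e f g)
    (e f g : Bool × ℕ × ZMod 6) (he : e.2.1 < n) (hf : f.2.1 < n) (hg : g.2.1 < n)
    (hef : Apart n e f) (heg : Apart n e g) (hfg : Apart n f g) : Joinable n e f g := by
  obtain ⟨k, hk⟩ : ∃ k, e.2.1 = k := ⟨_, rfl⟩
  induction k generalizing e f g with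
  | zero => exact H e f g hk hf hg hef heg hfg
  | succ k ih =>
    obtain ⟨D, hD, h1, h2, h3⟩ := ih (rotate n e) (rotate n f) (rotate n g) (rotate_col_lt he)
      (rotate_col_lt hf) (rotate_col_lt hg) (hef.rotate hn he hf) (heg.rotate hn he hg)
      (hfg.rotate hn hf hg) (by
        obtain ⟨b, j, i⟩ := e
        simp only at hk
        simp [rotate, hk])
    exact ⟨D ∘ rotate n, hD.comp_rotate hn, h1, h2, h3⟩

/-! ### Inserting two columns -/

/-- The edge of `C₆ ⋈ P_n` that an edge of `C₆ ⋈ P_{n+2}` becomes when columns `k + 1` and `k + 2`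
are deleted. -/
def collapse (k : ℕ) : Bool × ℕ × ZMod 6 → Bool × ℕ × ZMod 6
  | (b, j, i) => (b, if j ≤ k then j else j - 2, i)

/-- Given a perfect matching of `C₆ ⋈ P_n`, insert two columns after column `k`. -/
def insertColumns (k : ℕ) (D : Bool × ℕ × ZMod 6 → Bool) : Bool × ℕ × ZMod 6 → Bool
  | (true, j, i) => bif decide (j = k + 1) then !D (true, k, i) else D (collapse k (true, j, i))
  | (false, j, i) =>
    bif decide (j = k + 1 ∨ j = k + 2) then false else D (collapse k (false, j, i))

lemma isDimer_insertColumns {n k : ℕ} (hk : k < n) {D : Bool × ℕ × ZMod 6 → Bool}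
    (hD : IsDimer n D) : IsDimer (n + 2) (insertColumns k D) := by
  intro j hj i
  rcases Nat.eq_zero_or_pos j with rfl | hj0
  · have h := hD 0 (by omega) i
    by_cases h1 : n = k + 1
    · subst h1
      simpa [insertColumns, collapse, prev] using h
    · have h2 : n ≠ k := by omega
      have h3 : ¬ n + 1 ≤ k := by omega
      simpa [insertColumns, collapse, prev, h1, h2, h3] using h
  · have hj0' : j ≠ 0 := by omega
    rcases lt_trichotomy j (k + 1) with h1 | rfl | h1
    · have h := hD j (by omega) i
      have h2 : j ≤ k := by omega
      have h3 : j ≠ k + 1 := by omega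
      have h4 : j ≠ k + 2 := by omega
      have h5 : j - 1 ≠ k + 1 := by omega
      have h6 : j - 1 ≤ k := by omega
      simpa [insertColumns, collapse, prev, hj0', h2, h3, h4, h5, h6] using h
    · cases h : D (true, k, i) <;> simp [insertColumns, collapse, prev, exactlyOne, h]
    · obtain ⟨m, rfl⟩ : ∃ m, j = k + 2 + m := ⟨j - (k + 2), by omega⟩
      rcases m with _ | m
      · cases h : D (true, k, i) <;> simp [insertColumns, collapse, prev, exactlyOne, h]
      · have h := hD (k + 1 + m) (by omega) i
        have e1 : k + 2 + (m + 1) - 2 = k + 1 + m := by omega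
        have e2 : k + 2 + (m + 1) - 1 = k + 2 + m := by omega
        have e3 : k + 2 + m - 2 = k + m := by omega
        have e4 : k + 1 + m - 1 = k + m := by omega
        have h2 : ¬ k + 2 + (m + 1) ≤ k := by omega
        have h3 : k + 2 + (m + 1) ≠ k + 1 := by omega
        have h4 : k + 2 + (m + 1) ≠ k + 2 := by omega
        have h5 : k + 2 + m ≠ k + 1 := by omega
        have h6 : ¬ k + 2 + m ≤ k := by omega
        have h7 : k + 1 + m ≠ 0 := by omega
        simp only [prev, h7, if_false, e4] at h
        simpa only [insertColumns, collapse, prev, hj0', e1, e2, e3, h2, h3, h4, h5, h6, if_false,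
          decide_false, cond_false, or_self] using h

/-- The effect of deleting columns `k + 1` and `k + 2` on vertices. -/
def collapseVertex (k : ℕ) (p : ℕ × ZMod 6) : ℕ × ZMod 6 :=
  (if p.1 ≤ k then p.1 else p.1 - 2, p.2)

lemma collapseVertex_injOn (k : ℕ) :
    Set.InjOn (collapseVertex k) {p | p.1 ≤ k ∨ k + 2 < p.1} := by
  rintro ⟨j, i⟩ hj ⟨j', i'⟩ hj' h
  simp only [Set.mem_ofPred_eq] at hj hj'
  simp only [collapseVertex, Prod.mk.injEq] at h ⊢
  refine ⟨?_, h.2⟩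
  have h1 := h.1
  split_ifs at h1 <;> omega

lemma target_collapse {n k : ℕ} (hk : k < n) {e : Bool × ℕ × ZMod 6} (he : e.2.1 < n + 2)
    (he' : e.2.1 < k ∨ k + 2 < e.2.1) :
    target n (collapse k e) = collapseVertex k (target (n + 2) e) ∧
      ((target (n + 2) e).1 ≤ k ∨ k + 2 < (target (n + 2) e).1) := by
  obtain ⟨_ | _, j, i⟩ := e
  · simp only at he he'
    exact ⟨rfl, by simp only [target]; omega⟩
  · simp only at he he'
    rcases he' with h | h
    · have h1 : j + 1 ≠ n := by omega
      have h2 : j ≠ n + 1 := by omega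
      simp [target, collapse, collapseVertex, h1, h2, h.le, Nat.succ_le_of_lt h]
    · have h0 : ¬ j ≤ k := by omega
      have h3 : ¬ j + 1 ≤ k := by omega
      have h5 : j - 2 + 1 = j - 1 := by omega
      by_cases h1 : j = n + 1
      · subst h1
        have h6 : ¬ n + 1 ≤ k := by omega
        have h7 : n - 1 + 1 = n := by omega
        simp [target, collapse, collapseVertex, h6, h7]
      · have h2 : j - 1 ≠ n := by omega
        have h4 : k + 2 < j + 1 := by omega
        simp [target, collapse, collapseVertex, h0, h1, h2, h3, h4, h5]

lemma Apart.collapse {n k : ℕ} (hk : k < n) {e f : Bool × ℕ × ZMod 6}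
    (he : e.2.1 < n + 2) (hf : f.2.1 < n + 2) (he' : e.2.1 < k ∨ k + 2 < e.2.1)
    (hf' : f.2.1 < k ∨ k + 2 < f.2.1) (h : Apart (n + 2) e f) :
    Apart n (collapse k e) (collapse k f) := by
  obtain ⟨h1, h2⟩ := target_collapse hk he he'
  obtain ⟨h3, h4⟩ := target_collapse hk hf hf'
  have hinj : ∀ {p q : ℕ × ZMod 6}, (p.1 ≤ k ∨ k + 2 < p.1) → (q.1 ≤ k ∨ k + 2 < q.1) → p ≠ q →
      collapseVertex k p ≠ collapseVertex k q :=
    fun hp hq hne hpq => hne (collapseVertex_injOn k hp hq hpq)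
  have h5 : e.2.1 ≤ k ∨ k + 2 < e.2.1 := by omega
  have h6 : f.2.1 ≤ k ∨ k + 2 < f.2.1 := by omega
  unfold Apart
  rw [h1, h3]
  exact ⟨hinj h5 h6 h.1, hinj h5 h4 h.2.1, hinj h2 h6 h.2.2.1, hinj h2 h4 h.2.2.2⟩

lemma insertColumns_eq_collapse {k : ℕ} {D : Bool × ℕ × ZMod 6 → Bool} {e : Bool × ℕ × ZMod 6}
    (he : e.2.1 < k ∨ k + 2 < e.2.1) : insertColumns k D e = D (collapse k e) := by
  obtain ⟨_ | _, j, i⟩ := e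
  · have : ¬(j = k + 1 ∨ j = k + 2) := by simp only at he; omega
    simp [insertColumns, this]
  · have : ¬(j = k + 1) := by simp only at he; omega
    simp [insertColumns, this]

lemma joinable_add_two {n : ℕ} (hn : 9 ≤ n)
    (H : ∀ e f g, e.2.1 < n → f.2.1 < n → g.2.1 < n → Apart n e f → Apart n e g → Apart n f g →
      Joinable n e f g)
    (e f g : Bool × ℕ × ZMod 6) (he : e.2.1 = 0) (hf : f.2.1 < n + 2) (hg : g.2.1 < n + 2)
    (hef : Apart (n + 2) e f) (heg : Apart (n + 2) e g) (hfg : Apart (n + 2) f g) :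
    Joinable (n + 2) e f g := by
  obtain ⟨k, hk, he', hf', hg'⟩ : ∃ k < n, (e.2.1 < k ∨ k + 2 < e.2.1) ∧
      (f.2.1 < k ∨ k + 2 < f.2.1) ∧ (g.2.1 < k ∨ k + 2 < g.2.1) := by
    by_contra hno
    push Not at hno
    have h1 := hno 1 (by omega)
    have h2 := hno (f.2.1 + 1)
    have h3 := hno (g.2.1 + 1)
    omega
  have hlt : ∀ {x : Bool × ℕ × ZMod 6}, x.2.1 < n + 2 → (x.2.1 < k ∨ k + 2 < x.2.1) →
      (collapse k x).2.1 < n := by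
    rintro ⟨b, j, i⟩ h1 h2
    simp only [collapse]
    simp only at h1 h2
    split_ifs <;> omega
  have he0 : e.2.1 < n + 2 := by omega
  obtain ⟨D, hD, h1, h2, h3⟩ := H (collapse k e) (collapse k f) (collapse k g) (hlt he0 he')
    (hlt hf hf') (hlt hg hg') (hef.collapse hk he0 hf he' hf') (heg.collapse hk he0 hg he' hg')
    (hfg.collapse hk hf hg hf' hg')
  refine ⟨_, isDimer_insertColumns hk hD, ?_, ?_, ?_⟩ <;>
    rwa [insertColumns_eq_collapse] <;> assumption

/-! ### The cases `n = 5, 7, 9`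

A set of edges is encoded by a natural number, the edge `(b, j, i)` being the bit
`code (b, j, i)`. -/

/-- The position of the bit of an edge. -/
def code (e : Bool × ℕ × ZMod 6) : ℕ :=
  12 * e.2.1 + (bif e.1 then 0 else 6) + e.2.2.val

lemma code_injective : Function.Injective code := by
  rintro ⟨b, j, i⟩ ⟨b', j', i'⟩ h
  have hi : i.val < 6 := i.val_lt
  have hi' : i'.val < 6 := i'.val_lt
  cases b <;> cases b' <;> simp only [code, cond_true, cond_false] at h
  · exact Prod.ext rfl (Prod.ext (by simp only; omega) (ZMod.val_injective 6 (by simp only; omega)))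
  · omega
  · omega
  · exact Prod.ext rfl (Prod.ext (by simp only; omega) (ZMod.val_injective 6 (by simp only; omega)))

lemma code_lt {n : ℕ} {e : Bool × ℕ × ZMod 6} (he : e.2.1 < n) : code e < 12 * n := by
  obtain ⟨b, j, i⟩ := e
  have hi : i.val < 6 := i.val_lt
  simp only at he
  cases b <;> simp only [code, cond_true, cond_false] <;> omega

/-- Whether `P` contains the edge `e` with `m = 2 ^ code e`, in a form that the kernel evaluates
quickly. -/
def hasBit (P m : ℕ) : Bool := !Nat.beq (Nat.land P m) 0

lemma hasBit_eq_testBit (P c : ℕ) : hasBit P (1 <<< c) = P.testBit c := by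
  have h : Nat.land P (2 ^ c) = (P.testBit c).toNat * 2 ^ c := Nat.and_two_pow P c
  rw [hasBit, Nat.one_shiftLeft, h]
  cases P.testBit c <;> simp [← Bool.not_eq_true]

/-- The edges at a vertex. -/
def star (n : ℕ) (p : ℕ × ZMod 6) : ℕ :=
  1 <<< code (true, p) ||| 1 <<< code (true, prev n p) ||| 1 <<< code (false, p) |||
    1 <<< code (false, p.1, p.2 - 1)

/-- The edges meeting a given edge. -/
def near (n : ℕ) (e : Bool × ℕ × ZMod 6) : ℕ :=
  star n (source e) ||| star n (target n e)

lemma testBit_one_shiftLeft_code {e f : Bool × ℕ × ZMod 6} :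
    (1 <<< code e).testBit (code f) = true ↔ f = e := by
  rw [Nat.one_shiftLeft, Nat.testBit_two_pow, decide_eq_true_iff, code_injective.eq_iff, eq_comm]

lemma incident_of_testBit_star {n : ℕ} {p : ℕ × ZMod 6} {f : Bool × ℕ × ZMod 6} (hp : p.1 < n)
    (h : (star n p).testBit (code f) = true) : source f = p ∨ target n f = p := by
  simp only [star, Nat.testBit_or, Bool.or_eq_true, testBit_one_shiftLeft_code, or_assoc] at h
  exact incident_of_eq hp h

lemma Apart.testBit_near {n : ℕ} {e f : Bool × ℕ × ZMod 6} (he : e.2.1 < n) (h : Apart n e f) :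
    (near n e).testBit (code f) = false := by
  rw [← Bool.not_eq_true, near, Nat.testBit_or, Bool.or_eq_true]
  rintro (h' | h')
  · rcases incident_of_testBit_star he h' with h' | h'
    exacts [h.1 h'.symm, h.2.1 h'.symm]
  · rcases incident_of_testBit_star (target_col_lt he) h' with h' | h'
    exacts [h.2.2.1 h'.symm, h.2.2.2 h'.symm]

/-- `force m k = k m`, but evaluating `force m k` in the kernel computes `m` first. -/
def force {α : Type} (m : ℕ) (k : ℕ → α) : α :=
  Nat.rec (k 0) (fun m _ => k m.succ) m

lemma force_eq {α : Type} (m : ℕ) (k : ℕ → α) : force m k = k m := by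
  cases m <;> rfl

/-- `forceList l k = k l`, but evaluating `forceList l k` in the kernel computes `l` first. -/
def forceList : List ℕ → (List ℕ → Bool) → Bool
  | [], k => k []
  | a :: l, k => force a fun a => forceList l fun l => k (a :: l)

lemma forceList_eq (l : List ℕ) (k : List ℕ → Bool) : forceList l k = k l := by
  induction l generalizing k with
  | nil => rfl
  | cons a l ih => rw [forceList, force_eq, ih]

/-- The list of all rows. -/
def rows : List (ZMod 6) := [0, 1, 2, 3, 4, 5]

lemma mem_rows (i : ZMod 6) : i ∈ rows := by
  revert i
  decide

/-- The edges `(b, j, i)` for a given `j`. -/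
def columnEdges (j : ℕ) : List (Bool × ℕ × ZMod 6) :=
  rows.map (fun i => (true, j, i)) ++ rows.map fun i => (false, j, i)

lemma mem_columnEdges (e : Bool × ℕ × ZMod 6) : e ∈ columnEdges e.2.1 := by
  obtain ⟨_ | _, j, i⟩ := e <;> simp [columnEdges, mem_rows]

/-- All members of `F` are perfect matchings. -/
def allDimers (n : ℕ) (F : List ℕ) : Bool :=
  (List.range n).all fun j => rows.all fun i =>
    force (1 <<< code (true, j, i)) fun a => force (1 <<< code (true, prev n (j, i))) fun b =>
      force (1 <<< code (false, j, i)) fun c => force (1 <<< code (false, j, i - 1)) fun d =>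
        F.all fun P => exactlyOne (hasBit P a) (hasBit P b) (hasBit P c) (hasBit P d)

/-- The union of `u` and the members of `F` containing the edge given by `m`. -/
def unionWith (m u : ℕ) (F : List ℕ) : ℕ :=
  List.rec u (fun P _ u => bif hasBit P m then Nat.lor P u else u) F

lemma exists_of_testBit_unionWith {F : List ℕ} {m u d : ℕ} (hu : u.testBit d = false)
    (h : (unionWith m u F).testBit d = true) :
    ∃ P ∈ F, hasBit P m = true ∧ P.testBit d = true := by
  induction F with
  | nil => simp [unionWith, hu] at h
  | cons P F ih =>
    simp only [unionWith] at h
    cases hc : hasBit P m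
    · rw [hc, cond_false] at h
      obtain ⟨Q, hQ, hQ'⟩ := ih h
      exact ⟨Q, List.mem_cons_of_mem _ hQ, hQ'⟩
    · rw [hc, cond_true, show ∀ u, Nat.lor P u = P ||| u from fun _ => rfl, Nat.testBit_or,
        Bool.or_eq_true] at h
      rcases h with h | h
      · exact ⟨P, List.mem_cons_self, hc, h⟩
      · obtain ⟨Q, hQ, hQ'⟩ := ih h
        exact ⟨Q, List.mem_cons_of_mem _ hQ, hQ'⟩

/-- All triples of pairwise disjoint edges, the first one in column `0`, are contained in members
of `F`. -/
def allCovered (n : ℕ) (F : List ℕ) : Bool :=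
  (columnEdges 0).all fun e => force (1 <<< code e) fun a => force (near n e) fun r =>
    forceList (F.filter fun P => hasBit P a) fun F =>
      (List.range n).all fun j => (columnEdges j).all fun f => force (1 <<< code f) fun b =>
        hasBit r b || force (r ||| near n f) fun u =>
          Nat.beq (unionWith b u F) (1 <<< (12 * n) - 1)

lemma joinable_of_allCovered {n : ℕ} {F : List ℕ} (h1 : allDimers n F = true)
    (h2 : allCovered n F = true) (e f g : Bool × ℕ × ZMod 6) (he : e.2.1 = 0) (hf : f.2.1 < n)
    (hg : g.2.1 < n) (hef : Apart n e f) (heg : Apart n e g) (hfg : Apart n f g) :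
    Joinable n e f g := by
  have hn : e.2.1 < n := by omega
  simp only [allCovered, force_eq, forceList_eq, List.all_eq_true, Bool.or_eq_true,
    List.mem_range, hasBit_eq_testBit] at h2
  have hcov := (h2 e (he ▸ mem_columnEdges e) f.2.1 hf f (mem_columnEdges f)).resolve_left
    (by simp [hef.testBit_near hn])
  have hu : (near n e ||| near n f).testBit (code g) = false := by
    rw [Nat.testBit_or, heg.testBit_near hn, hfg.testBit_near hf, Bool.or_self]
  have hbit := congrArg (fun m : ℕ => m.testBit (code g)) (Nat.eq_of_beq_eq_true hcov)
  simp only [Nat.one_shiftLeft (12 * n), Nat.testBit_two_pow_sub_one, code_lt hg, decide_true]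
    at hbit
  obtain ⟨P, hP, hPf, hPg⟩ := exists_of_testBit_unionWith hu hbit
  rw [hasBit_eq_testBit] at hPf
  rw [List.mem_filter] at hP
  refine ⟨fun e => P.testBit (code e), fun j hj i => ?_, hP.2, hPf, hPg⟩
  simp only [allDimers, force_eq, List.all_eq_true, List.mem_range, hasBit_eq_testBit] at h1
  exact h1 j hj i (mem_rows i) P hP.1

/-- The image of a set of edges of column `0` under the reflection `i ↦ 2 - i` of the rows. -/
def reflectMask (x : ℕ) : ℕ :=
  x &&& 18 ||| (x &&& 9) <<< 2 ||| x >>> 2 &&& 9 |||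
    (x &&& 576) <<< 1 ||| x >>> 1 &&& 576 ||| (x &&& 256) <<< 3 ||| x >>> 3 &&& 256

/-- The image of a set of edges under moving every column one step back. -/
def rotateMask (n P : ℕ) : ℕ :=
  P >>> 12 ||| reflectMask P <<< (12 * (n - 1))

/-- The image of a set of edges under `i ↦ i + 3` in all columns. -/
def shiftMask (n P : ℕ) : ℕ :=
  force ((1 <<< (12 * n) - 1) / 63 * 7) fun a => (P &&& a) <<< 3 ||| (P >>> 3 &&& a)

/-- The first `k` images of `P` under iterated rotation. -/
def rotations (n : ℕ) : ℕ → ℕ → List ℕ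
  | 0, _ => []
  | k + 1, P => P :: force (rotateMask n P) (rotations n k)

/-- The images of the members of `F` under rotations and `shiftMask`. -/
def orbits (n : ℕ) (F : List ℕ) : List ℕ :=
  F.flatMap fun P => rotations n (2 * n) P ++ force (shiftMask n P) (rotations n (2 * n))

/-- The images of the members of `F` under symmetries of `C₆ ⋈ P_n` are perfect matchings in which
all triples of disjoint edges occur. -/
def isCertificate (n : ℕ) (F : List ℕ) : Bool :=
  forceList (orbits n F) fun F => allDimers n F && allCovered n F

lemma joinable_of_isCertificate {n : ℕ} {F : List ℕ} (hn : 3 ≤ n) (h : isCertificate n F = true) :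
    ∀ e f g, e.2.1 < n → f.2.1 < n → g.2.1 < n → Apart n e f → Apart n e g → Apart n f g →
      Joinable n e f g := by
  rw [isCertificate, forceList_eq, Bool.and_eq_true] at h
  exact joinable_of_first_col_zero hn (joinable_of_allCovered h.1 h.2)

/-- Perfect matchings of `C₆ ⋈ P₅`. -/
def matchings5 : List ℕ :=
  [360305774709178675, 289999054423982628, 576462823041821312, 378337562319651855,
   648677958064013497, 583216567169318927, 360376182380954944, 581602936260419873,
   360376148018469504, 722304374344877312, 326880417531707419, 31526027178541217,
   378460698675697938, 583251753290506316, 52152055012261891, 756692719853633599,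
   103741160062713895]

/-- Perfect matchings of `C₆ ⋈ P₇`. -/
def matchings7 : List ℕ :=
  [9673802507967456048454150, 5441505054471679270478497, 6349959984468281614563480,
   10278258898237544527921825, 10883009820641519503148291, 1738494958617639247773735,
   874892199345283611750464, 1294114656005870886920481, 142447667303018779389964,
   2604680916885061840977968, 2892597069522103787820038, 302300991484658800843026,
   5440324242235526214060184]

/-- Perfect matchings of `C₆ ⋈ P₉`. -/
def matchings9 : List ℕ :=
  [162299483889249271594123471620126, 203325474447328985059369165259788,
   2615112224013024670435994949650, 22941854489959697992492633891904,
   48488873987441556872091666519046, 162777212688420773609364773930240,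
   81129928784675244314945727308449, 81842808203295602881592828412480,
   81625000634559709869173114941988, 43441855025064293106292709429302,
   182586610118717972553639194050867, 182586606489843110880878713471588,
   91293312917728617035495327177344]

lemma isCertificate_matchings5 : isCertificate 5 matchings5 = true := by decide +kernel

lemma isCertificate_matchings7 : isCertificate 7 matchings7 = true := by decide +kernel

lemma isCertificate_matchings9 : isCertificate 9 matchings9 = true := by decide +kernel

lemma joinable_of_apart {n : ℕ} (hn : 5 ≤ n) (hno : Odd n) :
    ∀ e f g, e.2.1 < n → f.2.1 < n → g.2.1 < n → Apart n e f → Apart n e g → Apart n f g →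
      Joinable n e f g := by
  induction n using Nat.strong_induction_on with
  | _ n ih =>
    obtain ⟨m, rfl⟩ := hno
    obtain rfl | rfl | rfl | hm : m = 2 ∨ m = 3 ∨ m = 4 ∨ 5 ≤ m := by omega
    · exact joinable_of_isCertificate (by norm_num) isCertificate_matchings5
    · exact joinable_of_isCertificate (by norm_num) isCertificate_matchings7
    · exact joinable_of_isCertificate (by norm_num) isCertificate_matchings9
    · obtain ⟨m, rfl⟩ : ∃ k, m = k + 1 := ⟨m - 1, by omega⟩
      exact joinable_of_first_col_zero (by omega)
        (joinable_add_two (n := 2 * m + 1) (by omega)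
          (ih (2 * m + 1) (by omega) (by omega) ⟨m, rfl⟩))

end BowTie

/-- For odd `n ≥ 5`, the bow-tie graph `C₆ ⋈ P_n` is `3`-extendable. -/
theorem bowTie_three_extendable (n : ℕ) (hn : 5 ≤ n) (hno : Odd n) :
    Extendable (bowTie n) 3 := by
  exact BowTie.extendable_of_joinable (by omega) (BowTie.joinable_of_apart hn hno)
end

section
/- Let n ≥ 5 be an odd integer and let B_n be the graph with vertex set H ∪ Q, where H = {h_1,…,h_n} (indices mod n) and Q = {q_1,…,q_{2n}} (indices mod 2n), whose edges are h_i h_{i+1} for all i, q_j q_{j+1} for all j, and h_i q_i and h_i q_{i+n} for all i ∈ {1,…,n}. Then every 3-matching of B_n is contained in a matching of B_n that covers every vertex of H. -/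
open SimpleGraph

/-- The defining relation of the graph `B_n`: vertex set `H ⊕ Q` with
`H = ZMod n` (inducing a cycle `h_i h_{i+1}`), `Q = ZMod (2n)` (inducing a cycle
`q_j q_{j+1}`), and spoke edges `h_i q_i`, `h_i q_{i+n}` (equivalently, `q_j` is joined
to `h_{j mod n}`). -/
def bRel (n : ℕ) : (ZMod n ⊕ ZMod (2 * n)) → (ZMod n ⊕ ZMod (2 * n)) → Prop
  | Sum.inl a, Sum.inl b => b = a + 1
  | Sum.inr a, Sum.inr b => b = a + 1
  | Sum.inl a, Sum.inr b => a = (b.val : ZMod n)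
  | Sum.inr _, Sum.inl _ => False

/-- The graph `B_n = (C₆ ⋈ P_n)[J]`. -/
def Bgraph (n : ℕ) : SimpleGraph (ZMod n ⊕ ZMod (2 * n)) :=
  SimpleGraph.fromRel (bRel n)

/-- The vertex `v` is an endpoint of some edge of `M`. -/
def Covers {V : Type*} (M : Set (Sym2 V)) (v : V) : Prop := ∃ e ∈ M, v ∈ e

/-- The index of the unique vertex of `H` joined to `q_j` by a spoke. -/
def spokeIndex (n : ℕ) : ZMod (2 * n) →+* ZMod n := ZMod.castHom (dvd_mul_left n 2) (ZMod n)

/-- The vertex `h_a` is uncovered by `M`, but both of its neighbours in `Q` are covered. -/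
def Blocked {n : ℕ} (M : Set (Sym2 (ZMod n ⊕ ZMod (2 * n)))) (a : ZMod n) : Prop :=
  ¬ Covers M (Sum.inl a) ∧ ∀ b, spokeIndex n b = a → Covers M (Sum.inr b)

theorem IsMatchingSet.eq_of_mem {V : Type*} {G : SimpleGraph V} {M : Set (Sym2 V)}
    (hM : IsMatchingSet G M) {e f : Sym2 V} (he : e ∈ M) (hf : f ∈ M) {v : V}
    (hve : v ∈ e) (hvf : v ∈ f) : e = f := by
  by_contra h
  exact hM.2 he hf h v hve hvf

theorem IsMatchingSet.insert {V : Type*} {G : SimpleGraph V} {M : Set (Sym2 V)}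
    (hM : IsMatchingSet G M) {v w : V} (hvw : G.Adj v w) (hv : ¬ Covers M v)
    (hw : ¬ Covers M w) : IsMatchingSet G (insert s(v, w) M) := by
  refine ⟨Set.insert_subset hvw hM.1, hM.2.insert fun f hf _ => ⟨fun x hx hxf => ?_,
    fun x hxf hx => ?_⟩⟩ <;>
  · rcases Sym2.mem_iff.1 hx with rfl | rfl
    · exact hv ⟨f, hf, hxf⟩
    · exact hw ⟨f, hf, hxf⟩

theorem adj_of_mem_edge {V : Type*} {G : SimpleGraph V} {e : Sym2 V} (he : e ∈ G.edgeSet)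
    {v w : V} (hv : v ∈ e) (hw : w ∈ e) (hvw : v ≠ w) : G.Adj v w := by
  rw [(Sym2.mem_and_mem_iff hvw).1 ⟨hv, hw⟩] at he
  exact he

theorem mem_pair_of_ncard_three {α : Type*} {M : Set α} (hM : M.ncard = 3) {x y z w : α}
    (hx : x ∈ M) (hy : y ∈ M) (hz : z ∈ M) (hw : w ∈ M) (hxy : x ≠ y) (hzw : z ≠ w) :
    (z = x ∨ z = y) ∨ (w = x ∨ w = y) := by
  obtain ⟨p, q, r, -, -, -, rfl⟩ := Set.ncard_eq_three.1 hM
  simp only [Set.mem_insert_iff, Set.mem_singleton_iff] at hx hy hz hw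
  grind

section Bgraph

variable {n : ℕ}

theorem spokeIndex_apply [NeZero n] (b : ZMod (2 * n)) :
    spokeIndex n b = (b.val : ZMod n) := by
  rw [spokeIndex, ZMod.castHom_apply, ZMod.cast_eq_val]

theorem exists_spokeIndex_eq [NeZero n] (a : ZMod n) :
    ∃ b b', b ≠ b' ∧ spokeIndex n b = a ∧ spokeIndex n b' = a := by
  refine ⟨(a.val : ZMod (2 * n)), (a.val : ZMod (2 * n)) + (n : ZMod (2 * n)), ?_, ?_, ?_⟩
  · have hn := NeZero.pos n
    rw [ne_eq, left_eq_add, ZMod.natCast_eq_zero_iff]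
    exact fun h => absurd (Nat.le_of_dvd hn h) (by omega)
  · simp
  · simp

theorem Bgraph_adj_inl {a a' : ZMod n} :
    (Bgraph n).Adj (Sum.inl a) (Sum.inl a') ↔ a ≠ a' ∧ (a' = a + 1 ∨ a = a' + 1) := by
  simp [Bgraph, bRel]

theorem Bgraph_adj_inr {b b' : ZMod (2 * n)} :
    (Bgraph n).Adj (Sum.inr b) (Sum.inr b') ↔ b ≠ b' ∧ (b' = b + 1 ∨ b = b' + 1) := by
  simp [Bgraph, bRel]

theorem Bgraph_adj_inl_inr [NeZero n] {a : ZMod n} {b : ZMod (2 * n)} :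
    (Bgraph n).Adj (Sum.inl a) (Sum.inr b) ↔ spokeIndex n b = a := by
  simp [Bgraph, bRel, spokeIndex_apply, eq_comm]

theorem inl_mem_edge {e : Sym2 (ZMod n ⊕ ZMod (2 * n))} (he : e ∈ (Bgraph n).edgeSet)
    {a a' : ZMod n} (ha : Sum.inl a ∈ e) (ha' : Sum.inl a' ∈ e) (h : a ≠ a') :
    a' = a + 1 ∨ a = a' + 1 :=
  (Bgraph_adj_inl.1 (adj_of_mem_edge he ha ha' (by simpa using h))).2

theorem inr_mem_edge {e : Sym2 (ZMod n ⊕ ZMod (2 * n))} (he : e ∈ (Bgraph n).edgeSet)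
    {b b' : ZMod (2 * n)} (hb : Sum.inr b ∈ e) (hb' : Sum.inr b' ∈ e) (h : b ≠ b') :
    spokeIndex n b' = spokeIndex n b + 1 ∨ spokeIndex n b = spokeIndex n b' + 1 := by
  rcases (Bgraph_adj_inr.1 (adj_of_mem_edge he hb hb' (by simpa using h))).2 with rfl | rfl <;>
  simp

variable {M : Set (Sym2 (ZMod n ⊕ ZMod (2 * n)))}

theorem Blocked.exists_edges [Fact (1 < n)] (hM : M ⊆ (Bgraph n).edgeSet) {a : ZMod n}
    (ha : Blocked M a) : ∃ e ∈ M, ∃ f ∈ M, e ≠ f ∧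
      (∃ b, spokeIndex n b = a ∧ Sum.inr b ∈ e) ∧ ∃ b, spokeIndex n b = a ∧ Sum.inr b ∈ f := by
  have : NeZero n := ⟨(zero_lt_one.trans (Fact.out : 1 < n)).ne'⟩
  obtain ⟨b, b', hne, hb, hb'⟩ := exists_spokeIndex_eq a
  obtain ⟨e, he, hbe⟩ := ha.2 b hb
  obtain ⟨f, hf, hbf⟩ := ha.2 b' hb'
  refine ⟨e, he, f, hf, ?_, ⟨b, hb, hbe⟩, b', hb', hbf⟩
  rintro rfl
  simpa [hb, hb'] using inr_mem_edge (hM he) hbe hbf hne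

theorem Blocked.inl_notMem [NeZero n] (hM : M ⊆ (Bgraph n).edgeSet) {a : ZMod n}
    (ha : Blocked M a) {e : Sym2 (ZMod n ⊕ ZMod (2 * n))} (he : e ∈ M)
    (hb : ∃ b, spokeIndex n b = a ∧ Sum.inr b ∈ e) (c : ZMod n) : Sum.inl c ∉ e := by
  intro hc
  obtain ⟨b, rfl, hb⟩ := hb
  obtain rfl := Bgraph_adj_inl_inr.1 (adj_of_mem_edge (hM he) hc hb (by simp))
  exact ha.1 ⟨e, he, hc⟩

theorem Blocked.eq_add_one_or [Fact (1 < n)] (hM : M ⊆ (Bgraph n).edgeSet) (hM3 : M.ncard = 3)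
    {a a' : ZMod n} (ha : Blocked M a) (ha' : Blocked M a') (hne : a ≠ a') :
    a' = a + 1 ∨ a = a' + 1 := by
  obtain ⟨e, he, f, hf, hef, hbe, hbf⟩ := ha.exists_edges hM
  obtain ⟨e', he', f', hf', hef', hbe', hbf'⟩ := ha'.exists_edges hM
  have key : ∀ g ∈ M, (∃ b, spokeIndex n b = a ∧ Sum.inr b ∈ g) →
      (∃ b, spokeIndex n b = a' ∧ Sum.inr b ∈ g) → a' = a + 1 ∨ a = a' + 1 := by
    rintro g hg ⟨b, rfl, hb⟩ ⟨b', rfl, hb'⟩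
    exact inr_mem_edge (hM hg) hb hb' fun h => hne (congrArg _ h)
  rcases mem_pair_of_ncard_three hM3 he hf he' hf' hef hef' with (rfl | rfl) | (rfl | rfl)
  · exact key _ he hbe hbe'
  · exact key _ hf hbf hbe'
  · exact key _ he hbe hbf'
  · exact key _ hf hbf hbf'

/-- When some vertex is blocked, at most one edge of a `3`-matching meets `H`. -/
theorem Blocked.covered_eq_add_one_or [Fact (1 < n)] (hM : M ⊆ (Bgraph n).edgeSet)
    (hM3 : M.ncard = 3) {a c c' : ZMod n} (ha : Blocked M a) (hc : Covers M (Sum.inl c))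
    (hc' : Covers M (Sum.inl c')) (hne : c ≠ c') : c' = c + 1 ∨ c = c' + 1 := by
  have : NeZero n := ⟨(zero_lt_one.trans (Fact.out : 1 < n)).ne'⟩
  obtain ⟨e, he, f, hf, hef, hbe, hbf⟩ := ha.exists_edges hM
  obtain ⟨g, hg, hcg⟩ := hc
  obtain ⟨g', hg', hcg'⟩ := hc'
  by_cases hgg : g = g'
  · subst hgg
    exact inl_mem_edge (hM hg) hcg hcg' hne
  · rcases mem_pair_of_ncard_three hM3 he hf hg hg' hef hgg with (rfl | rfl) | (rfl | rfl)
    · exact absurd hcg (ha.inl_notMem hM he hbe _)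
    · exact absurd hcg (ha.inl_notMem hM hf hbf _)
    · exact absurd hcg' (ha.inl_notMem hM he hbe _)
    · exact absurd hcg' (ha.inl_notMem hM hf hbf _)

/-- A matching with no blocked vertex extends along spokes to a matching covering `H`. -/
theorem IsMatchingSet.exists_cover_of_forall_not_blocked [NeZero n]
    (hM : IsMatchingSet (Bgraph n) M) (h : ∀ a, ¬ Blocked M a) :
    ∃ M', IsMatchingSet (Bgraph n) M' ∧ M ⊆ M' ∧ ∀ a : ZMod n, Covers M' (Sum.inl a) := by
  have h' : ∀ a, ¬ Covers M (Sum.inl a) → ∃ b, spokeIndex n b = a ∧ ¬ Covers M (Sum.inr b) := by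
    intro a ha
    by_contra! hb
    exact h a ⟨ha, hb⟩
  choose! s hs hsM using h'
  let S : Set (Sym2 (ZMod n ⊕ ZMod (2 * n))) :=
    (fun a => s(Sum.inl a, Sum.inr (s a))) '' {a | ¬ Covers M (Sum.inl a)}
  have hMS : ∀ e ∈ M, ∀ f ∈ S, ∀ v, v ∈ e → v ∉ f := by
    rintro e he _ ⟨a, ha, rfl⟩ v hve hvf
    rcases Sym2.mem_iff.1 hvf with rfl | rfl
    · exact ha ⟨e, he, hve⟩
    · exact hsM a ha ⟨e, he, hve⟩
  refine ⟨M ∪ S, ⟨Set.union_subset hM.1 ?_, ?_⟩, Set.subset_union_left, fun a => ?_⟩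
  · rintro _ ⟨a, ha, rfl⟩
    exact Bgraph_adj_inl_inr.2 (hs a ha)
  · rintro e (he | he) f (hf | hf) hef
    · exact hM.2 he hf hef
    · exact hMS e he f hf
    · exact fun v hve hvf => hMS f hf e he v hvf hve
    · obtain ⟨a, ha, rfl⟩ := he
      obtain ⟨a', ha', rfl⟩ := hf
      have hne : a ≠ a' := fun h => hef (by rw [h])
      have hne' : s a ≠ s a' := fun h => hne (by rw [← hs a ha, h, hs a' ha'])
      intro v hv hv'
      rcases Sym2.mem_iff.1 hv with rfl | rfl <;> simp [hne, hne'] at hv'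
  · by_cases ha : Covers M (Sum.inl a)
    · exact ha.imp fun e he => ⟨Or.inl he.1, he.2⟩
    · exact ⟨_, Or.inr ⟨a, ha, rfl⟩, Sym2.mem_mk_left _ _⟩

/-- A blocked vertex of a `3`-matching has an uncovered neighbour in `H` such that no other vertex
is blocked. -/
theorem Blocked.exists_partner (hn : 5 ≤ n) (hM : M ⊆ (Bgraph n).edgeSet) (hM3 : M.ncard = 3)
    {a : ZMod n} (ha : Blocked M a) : ∃ d, (Bgraph n).Adj (Sum.inl a) (Sum.inl d) ∧
      ¬ Covers M (Sum.inl d) ∧ ∀ c, Blocked M c → c = a ∨ c = d := by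
  have : Fact (1 < n) := ⟨by omega⟩
  have ne_zero : ∀ k : ℕ, 0 < k → k < 5 → (k : ZMod n) ≠ 0 := fun k hk hk5 h =>
    absurd (Nat.le_of_dvd hk ((ZMod.natCast_eq_zero_iff k n).1 h)) (by omega)
  have h1 := ne_zero 1 (by omega) (by omega)
  have h2 := ne_zero 2 (by omega) (by omega)
  have h3 := ne_zero 3 (by omega) (by omega)
  push_cast at h1 h2 h3
  have hdist : a + 1 ≠ a - 1 := fun h => h2 (by linear_combination h)
  have hnadj : ¬ (a - 1 = a + 1 + 1 ∨ a + 1 = a - 1 + 1) := by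
    rintro (h | h)
    · exact h3 (by linear_combination -h)
    · exact h1 (by linear_combination h)
  have hadj : ∀ c, c = a + 1 ∨ c = a - 1 → (Bgraph n).Adj (Sum.inl a) (Sum.inl c) := by
    rintro c (rfl | rfl) <;> simp [Bgraph_adj_inl, h1, eq_sub_iff_add_eq]
  have hnear : ∀ c, Blocked M c → c = a ∨ c = a + 1 ∨ c = a - 1 := by
    intro c hc
    by_cases hca : a = c
    · exact Or.inl hca.symm
    · exact Or.inr ((ha.eq_add_one_or hM hM3 hc hca).imp id fun h => eq_sub_of_add_eq h.symm)
  by_cases hp : Blocked M (a + 1)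
  · refine ⟨a + 1, hadj _ (Or.inl rfl), hp.1, fun c hc => ?_⟩
    rcases hnear c hc with h | h | rfl
    · exact Or.inl h
    · exact Or.inr h
    · exact absurd (hp.eq_add_one_or hM hM3 hc hdist) hnadj
  by_cases hm : Covers M (Sum.inl (a - 1))
  · refine ⟨a + 1, hadj _ (Or.inl rfl), fun h => ?_, fun c hc => ?_⟩
    · exact hnadj (ha.covered_eq_add_one_or hM hM3 h hm hdist)
    · rcases hnear c hc with h | h | rfl
      · exact Or.inl h
      · exact Or.inr h
      · exact absurd hm hc.1
  · refine ⟨a - 1, hadj _ (Or.inr rfl), hm, fun c hc => ?_⟩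
    rcases hnear c hc with h | rfl | h
    · exact Or.inl h
    · exact absurd hc hp
    · exact Or.inr h

end Bgraph

/-- for odd `n ≥ 5`, every 3-matching of `B_n` extends to a matching
covering every vertex of `H`. -/
theorem Bgraph_three_matching_extends_to_cover_H (n : ℕ) (hn : 5 ≤ n) (hno : Odd n)
    (M : Set (Sym2 (ZMod n ⊕ ZMod (2 * n))))
    (hM : IsMatchingSet (Bgraph n) M) (hM3 : M.ncard = 3) :
    ∃ M', IsMatchingSet (Bgraph n) M' ∧ M ⊆ M' ∧
      ∀ a : ZMod n, ∃ e ∈ M', (Sum.inl a : ZMod n ⊕ ZMod (2 * n)) ∈ e := by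
  have : NeZero n := ⟨by omega⟩
  by_cases h : ∀ a, ¬ Blocked M a
  · exact hM.exists_cover_of_forall_not_blocked h
  push Not at h
  obtain ⟨a, ha⟩ := h
  obtain ⟨d, had, hd, hblocked⟩ := ha.exists_partner hn hM.1 hM3
  have hfree : ∀ c, ¬ Blocked (insert s(Sum.inl a, Sum.inl d) M) c := by
    rintro c ⟨hc, hcQ⟩
    have hcM : Blocked M c := by
      refine ⟨fun ⟨e, he, hce⟩ => hc ⟨e, Or.inr he, hce⟩, fun b hb => ?_⟩
      obtain ⟨e, rfl | he, hbe⟩ := hcQ b hb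
      · simp at hbe
      · exact ⟨e, he, hbe⟩
    refine hc ⟨_, Or.inl rfl, ?_⟩
    rcases hblocked c hcM with rfl | rfl <;> simp
  obtain ⟨M', hM', hsub, hcov⟩ :=
    (hM.insert had ha.1 hd).exists_cover_of_forall_not_blocked hfree
  exact ⟨M', hM', (Set.subset_insert _ _).trans hsub, hcov⟩
end

section
/- Let n ≥ 5 be an odd integer and let G = C_6 ⋈ P_n, with the relabeling h_i = v_{1i}, q_i = v_{6i}, q_{n+i} = v_{2i}, h_i' = v_{4i}, q_i' = v_{5i}, q_{n+i}' = v_{3i}, and H = {h_i : i ∈ [n]}, Q = {q_j : j ∈ [2n]}, J = H ∪ Q, and H', Q', J' defined analogously with primes. Let M_0 be a 3-matching of G having no edge with both ends in J'. Then the induced subgraph G[J] has a matching M such that M contains every edge of M_0 lying in G[J], M covers every vertex of H, and M misses every vertex q_j for which q_j q_j' is an edge of M_0. -/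
open SimpleGraph

/-- The vertices covered by a set of edges. -/
def coveredSet {V : Type*} (M : Set (Sym2 V)) : Set V := {v | ∃ e ∈ M, v ∈ e}

/-- Pairwise nonadjacent covered vertices lie on distinct edges of a matching. -/
theorem IsMatchingSet.card_le_of_nonadj {V : Type*} {G : SimpleGraph V} {M : Set (Sym2 V)}
    (hM : IsMatchingSet G M) (hfin : M.Finite) (W : Finset V)
    (hcov : ∀ v ∈ W, v ∈ coveredSet M) (hind : ∀ v ∈ W, ∀ w ∈ W, ¬ G.Adj v w) :
    W.card ≤ M.ncard := by
  rcases W.eq_empty_or_nonempty with rfl | ⟨u, -⟩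
  · simp
  have : Nonempty (Sym2 V) := ⟨s(u, u)⟩
  choose! f hf hvf using hcov
  rw [← Set.ncard_coe_finset W]
  refine Set.ncard_le_ncard_of_injOn f (fun v hv => hf v hv) (fun v hv w hw h => ?_) hfin
  by_contra hne
  have he : f v = s(v, w) := (Sym2.mem_and_mem_iff hne).1 ⟨hvf v hv, h ▸ hvf w hw⟩
  exact hind v hv w hw (by simpa [he] using hM.1 (hf v hv))

namespace bowTie

variable {n : ℕ}

/-- Consecutive columns of the bow-tie graph, the last one being followed by the first one. -/
def ColAdj (c d : Fin n) : Prop :=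
  c.val + 1 = d.val ∨ d.val + 1 = c.val ∨ (c.val = 0 ∧ d.val = n - 1) ∨
    (d.val = 0 ∧ c.val = n - 1)

theorem adj_iff (p q : ZMod 6 × Fin n) :
    (bowTie n).Adj p q ↔
      ((p.1 ≠ q.1 ∧ (q.1 = p.1 + 1 ∨ p.1 = q.1 + 1)) ∧ p.2 = q.2) ∨
      (p.1 = q.1 ∧ (p.2.val + 1 = q.2.val ∨ q.2.val + 1 = p.2.val)) ∨
      (p ≠ q ∧ ((p.2.val = 0 ∧ q.2.val = n - 1 ∧ q.1 = 2 - p.1) ∨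
        (q.2.val = 0 ∧ p.2.val = n - 1 ∧ p.1 = 2 - q.1))) := by
  simp only [bowTie, cycleZMod, sup_adj, boxProd_adj, fromRel_adj, pathGraph_adj, or_assoc]
  tauto

theorem adj_row_one_iff (hn : 5 ≤ n) (c d : Fin n) :
    (bowTie n).Adj (1, c) (1, d) ↔ ColAdj c d := by
  have h : (1 : ZMod 6) = 2 - 1 := by decide
  have h0 : (1 : ZMod 6) ≠ 1 + 1 := by decide
  simp only [adj_iff, ColAdj, ne_eq, Prod.mk.injEq, ← h, Fin.ext_iff]
  have := c.2
  simp only [true_and, not_true_eq_false, false_and, false_or, and_true]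
  omega

theorem row_eq_of_adj {p q : ZMod 6 × Fin n} (h : (bowTie n).Adj p q) (hc : p.2 ≠ q.2) :
    ColAdj p.2 q.2 ∧ (p.1 = q.1 ∨ q.1 = 2 - p.1) := by
  rw [adj_iff] at h
  unfold ColAdj
  rcases h with h | h | ⟨-, h | h⟩
  · exact absurd h.2 hc
  · tauto
  · tauto
  · refine ⟨by tauto, .inr ?_⟩
    rw [h.2.2]
    ring

theorem not_adj_of_same_column (hn : 5 ≤ n) (c : Fin n) {r s : ZMod 6}
    (h : ¬ (s = r + 1 ∨ r = s + 1)) : ¬ (bowTie n).Adj (r, c) (s, c) := by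
  rw [adj_iff]
  rintro (h' | h' | ⟨-, h' | h'⟩)
  · exact h h'.1.2
  all_goals
    simp only at h'
    omega

theorem adj_row_one_spoke (c : Fin n) {r : ZMod 6} (hr : r = 0 ∨ r = 2) :
    (bowTie n).Adj (1, c) (r, c) := by
  rw [adj_iff]
  refine .inl ⟨?_, rfl⟩
  rcases hr with rfl | rfl <;> dsimp only <;> decide

theorem row_of_adj_row_one {c : Fin n} {q : ZMod 6 × Fin n} (h : (bowTie n).Adj (1, c) q) :
    q.1 = 0 ∨ q.1 = 1 ∨ q.1 = 2 := by
  have key : ∀ r : ZMod 6, (r = 1 + 1 ∨ 1 = r + 1) ∨ 1 = r ∨ r = 2 - 1 ∨ 1 = 2 - r →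
      r = 0 ∨ r = 1 ∨ r = 2 := by decide
  rw [adj_iff] at h
  exact key q.1 (by tauto)

theorem ColAdj.symm {c d : Fin n} (h : ColAdj c d) : ColAdj d c := by
  unfold ColAdj at *
  tauto

theorem not_colAdj_self (hn : 5 ≤ n) (c : Fin n) : ¬ ColAdj c c := by
  unfold ColAdj
  omega

theorem not_colAdj_triangle (hn : 5 ≤ n) {a b c : Fin n} (hab : ColAdj a b) (hac : ColAdj a c) :
    ¬ ColAdj b c := by
  unfold ColAdj at *
  omega

theorem exists_colAdj_pair (hn : 5 ≤ n) (c : Fin n) :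
    ∃ d e : Fin n, d ≠ e ∧ ColAdj c d ∧ ColAdj c e := by
  refine ⟨⟨if c.val = n - 1 then 0 else c.val + 1, by split_ifs <;> omega⟩,
    ⟨if c.val = 0 then n - 1 else c.val - 1, by split_ifs <;> omega⟩, ?_, ?_, ?_⟩
  · simp only [ne_eq, Fin.mk.injEq]
    split_ifs <;> omega
  all_goals
    simp only [ColAdj]
    split_ifs <;> omega

/-- Column `c` is blocked by `U` when its middle vertex is not in `U` but both neighbours of that
vertex in the rows `0` and `2` are. -/
def Blocked (U : Set (ZMod 6 × Fin n)) (c : Fin n) : Prop :=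
  (1, c) ∉ U ∧ (0, c) ∈ U ∧ (2, c) ∈ U

theorem colAdj_of_blocked (hn : 5 ≤ n) {M : Set (Sym2 (ZMod 6 × Fin n))}
    (hM : IsMatchingSet (bowTie n) M) (hcard : M.ncard = 3) {b c : Fin n}
    (hb : Blocked (coveredSet M) b) (hc : Blocked (coveredSet M) c) (hbc : b ≠ c) :
    ColAdj b c := by
  by_contra hcol
  have h02 : (0 : ZMod 6) ≠ 2 := by decide
  have := hM.card_le_of_nonadj (Set.finite_of_ncard_pos (by omega))
    (({0, 2} : Finset (ZMod 6)) ×ˢ {b, c}) ?_ ?_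
  · rw [Finset.card_product, Finset.card_pair h02, Finset.card_pair hbc] at this
    omega
  · rintro ⟨r, x⟩ h
    simp only [Finset.mem_product, Finset.mem_insert, Finset.mem_singleton] at h
    obtain ⟨rfl | rfl, rfl | rfl⟩ := h
    exacts [hb.2.1, hc.2.1, hb.2.2, hc.2.2]
  · rintro ⟨r, x⟩ h ⟨s, y⟩ h' hadj
    simp only [Finset.mem_product, Finset.mem_insert, Finset.mem_singleton] at h h'
    by_cases hxy : x = y
    · subst hxy
      refine not_adj_of_same_column hn x ?_ hadj
      have key : ∀ r s : ZMod 6, (r = 0 ∨ r = 2) → (s = 0 ∨ s = 2) →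
          ¬ (s = r + 1 ∨ r = s + 1) := by decide
      exact key r s h.1 h'.1
    · have := (row_eq_of_adj hadj hxy).1
      simp only at this
      have := this.symm
      grind

theorem exists_uncovered_neighbour (hn : 5 ≤ n) {M : Set (Sym2 (ZMod 6 × Fin n))}
    (hM : IsMatchingSet (bowTie n) M) (hcard : M.ncard = 3) {b : Fin n}
    (hb : Blocked (coveredSet M) b) : ∃ c, ColAdj b c ∧ (1, c) ∉ coveredSet M := by
  obtain ⟨d, e, hde, hd, he⟩ := exists_colAdj_pair hn b
  by_contra! hcon
  have hbd : b ≠ d := fun h => not_colAdj_self hn d (h ▸ hd)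
  have hbe : b ≠ e := fun h => not_colAdj_self hn e (h ▸ he)
  have h02 : (0 : ZMod 6) ≠ 2 := by decide
  have h01 : (0 : ZMod 6) ≠ 1 := by decide
  have h21 : (2 : ZMod 6) ≠ 1 := by decide
  have hspoke : ∀ x, b ≠ x → ∀ r : ZMod 6, r = 0 ∨ r = 2 →
      ¬ (bowTie n).Adj (r, b) (1, x) := by
    intro x hx r hr hadj
    have key : ∀ r : ZMod 6, (r = 0 ∨ r = 2) → ¬ (r = 1 ∨ 1 = 2 - r) := by decide
    exact key r hr (row_eq_of_adj hadj hx).2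
  have hdiag : ∀ r s : ZMod 6, (r = 0 ∨ r = 2) → (s = 0 ∨ s = 2) →
      ¬ (bowTie n).Adj (r, b) (s, b) := by
    intro r s hr hs
    refine not_adj_of_same_column hn b ?_
    revert r s
    decide
  have hnde : ¬ (bowTie n).Adj (1, d) (1, e) :=
    fun h => not_colAdj_triangle hn hd he ((adj_row_one_iff hn d e).1 h)
  have := hM.card_le_of_nonadj (Set.finite_of_ncard_pos (by omega))
    {(0, b), (2, b), (1, d), (1, e)} ?_ ?_
  · rw [Finset.card_eq_of_equiv_fin (n := 4) ?_] at this
    · omega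
    · refine Finset.equivFinOfCardEq ?_
      simp [Finset.card_insert_of_notMem, h02, h01, h21, hde]
  · have := hb.2
    have := hcon d hd
    have := hcon e he
    grind
  · intro v hv w hw hadj
    have := hadj.symm
    have := hadj.ne
    simp only [Finset.mem_insert, Finset.mem_singleton] at hv hw
    grind

/-- At most two columns are blocked by a `3`-matching, and they are neighbours; the middle vertex
of a blocked column can be paired with an uncovered middle vertex. -/
theorem exists_pair_of_blocked (hn : 5 ≤ n) {M : Set (Sym2 (ZMod 6 × Fin n))}
    (hM : IsMatchingSet (bowTie n) M) (hcard : M.ncard = 3) {b : Fin n}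
    (hb : Blocked (coveredSet M) b) :
    ∃ c, ColAdj b c ∧ (1, c) ∉ coveredSet M ∧
      ∀ x, Blocked (coveredSet M) x → x = b ∨ x = c := by
  by_cases h : ∃ c, c ≠ b ∧ Blocked (coveredSet M) c
  · obtain ⟨c, hcb, hc⟩ := h
    refine ⟨c, colAdj_of_blocked hn hM hcard hb hc hcb.symm, hc.1, fun x hx => ?_⟩
    by_contra! hne
    exact not_colAdj_triangle hn (colAdj_of_blocked hn hM hcard hx hb hne.1)
      (colAdj_of_blocked hn hM hcard hx hc hne.2)
      (colAdj_of_blocked hn hM hcard hb hc hcb.symm)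
  · obtain ⟨c, hc, hcU⟩ := exists_uncovered_neighbour hn hM hcard hb
    exact ⟨c, hc, hcU, fun x hx => .inl (by_contra fun hne => h ⟨x, hne, hx⟩)⟩

/-- The uncovered middle vertices can be matched injectively to uncovered vertices in the rows
`0`, `1`, `2`. -/
theorem exists_partner (hn : 5 ≤ n) {M : Set (Sym2 (ZMod 6 × Fin n))}
    (hM : IsMatchingSet (bowTie n) M) (hcard : M.ncard = 3) :
    ∃ f : Fin n → ZMod 6 × Fin n,
      (∀ c, (1, c) ∉ coveredSet M → f c ∉ coveredSet M ∧ (bowTie n).Adj (1, c) (f c)) ∧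
      (∀ c d, f c = (1, d) → f d = (1, c)) ∧ Function.Injective f := by
  classical
  have h0 : (0 : ZMod 6) ≠ 1 := by decide
  have h2 : (2 : ZMod 6) ≠ 1 := by decide
  let r : Fin n → ZMod 6 := fun c => if (0, c) ∈ coveredSet M then 2 else 0
  have hr : ∀ c, r c = 0 ∨ r c = 2 := fun c => by
    by_cases h : (0, c) ∈ coveredSet M <;> simp [r, h]
  have hr1 : ∀ c, r c ≠ 1 := fun c => by rcases hr c with h | h <;> rw [h] <;> assumption
  have hrU : ∀ c, (1, c) ∉ coveredSet M → ¬ Blocked (coveredSet M) c →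
      (r c, c) ∉ coveredSet M := by
    intro c hc hcb
    by_cases h : (0, c) ∈ coveredSet M
    · simpa [r, h] using fun h' => hcb ⟨hc, h, h'⟩
    · simp [r, h]
  by_cases hB : ∃ b, Blocked (coveredSet M) b
  · obtain ⟨a, ha⟩ := hB
    obtain ⟨b, hab, hbU, hall⟩ := exists_pair_of_blocked hn hM hcard ha
    have hne : a ≠ b := fun h => not_colAdj_self hn b (h ▸ hab)
    refine ⟨fun c => if c = a then (1, b) else if c = b then (1, a) else (r c, c), ?_, ?_, ?_⟩
    · intro c hc
      dsimp only
      split_ifs with hca hcb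
      · exact ⟨hbU, hca ▸ (adj_row_one_iff hn a b).2 hab⟩
      · exact ⟨ha.1, hcb ▸ (adj_row_one_iff hn b a).2 hab.symm⟩
      · exact ⟨hrU c hc fun h => (hall c h).elim hca hcb, adj_row_one_spoke c (hr c)⟩
    · intro c d
      grind
    · intro c d
      grind
  · refine ⟨fun c => (r c, c), fun c hc => ⟨hrU c hc fun h => hB ⟨c, h⟩,
      adj_row_one_spoke c (hr c)⟩, fun c d h => ?_, fun c d h => (Prod.ext_iff.1 h).2⟩
    exact absurd (Prod.ext_iff.1 h).1 (hr1 c)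

end bowTie

/-- Let `G = C₆ ⋈ P_n` (`n ≥ 5` odd), relabelled so that
`H = {v_{1i}}` (row 1), `Q = {v_{6i}} ∪ {v_{2i}}` (rows 6 = 0 and 2), `J = H ∪ Q`,
and symmetrically `H' = {v_{4i}}`, `Q' = {v_{5i}} ∪ {v_{3i}}`, `J' = H' ∪ Q'`;
the partner `q_j'` of `q_j = (r, c)` (with `r ∈ {0, 2}`) is `(-1 - r, c)`
(rows `0 ↔ 5` and `2 ↔ 3`). If `M₀` is a 3-matching of `G` with no edge having both
ends in `J'`, then the induced subgraph `G[J]` has a matching `M` (a matching of `G`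
all of whose edge-ends lie in `J`, i.e. in rows 0, 1, 2) such that `M` contains every
edge of `M₀` lying in `G[J]`, `M` covers every vertex of `H` (row 1), and `M` misses
every vertex `q_j` with `q_j q_j' ∈ M₀`. -/
theorem bowTie_faithful_matching_of_GJ (n : ℕ) (hn : 5 ≤ n) (hno : Odd n)
    (M₀ : Set (Sym2 (ZMod 6 × Fin n)))
    (hM₀ : IsMatchingSet (bowTie n) M₀) (hM₀3 : M₀.ncard = 3)
    (hnoco : ∀ e ∈ M₀, ¬ ∀ v ∈ e, (v.1 = 3 ∨ v.1 = 4 ∨ v.1 = 5)) :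
    ∃ M, IsMatchingSet (bowTie n) M ∧
      (∀ e ∈ M, ∀ v ∈ e, v.1 = 0 ∨ v.1 = 1 ∨ v.1 = 2) ∧
      (∀ e ∈ M₀, (∀ v ∈ e, v.1 = 0 ∨ v.1 = 1 ∨ v.1 = 2) → e ∈ M) ∧
      (∀ p : ZMod 6 × Fin n, p.1 = 1 → ∃ e ∈ M, p ∈ e) ∧
      (∀ p : ZMod 6 × Fin n, (p.1 = 0 ∨ p.1 = 2) →
        s(p, ((-1 - p.1, p.2) : ZMod 6 × Fin n)) ∈ M₀ → ∀ e ∈ M, p ∉ e) := by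
  obtain ⟨f, hf, hsymm, hinj⟩ := bowTie.exists_partner hn hM₀ hM₀3
  have hrow : ∀ c, (1, c) ∉ coveredSet M₀ → (f c).1 = 0 ∨ (f c).1 = 1 ∨ (f c).1 = 2 :=
    fun c hc => bowTie.row_of_adj_row_one (hf c hc).2
  have hdisj : ∀ c, (1, c) ∉ coveredSet M₀ → ∀ e ∈ M₀, ∀ v ∈ s((1, c), f c), v ∉ e := by
    intro c hc e he v hv hve
    rcases Sym2.mem_iff.1 hv with rfl | rfl
    · exact hc ⟨e, he, hve⟩
    · exact (hf c hc).1 ⟨e, he, hve⟩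
  refine ⟨{e ∈ M₀ | ∀ v ∈ e, v.1 = 0 ∨ v.1 = 1 ∨ v.1 = 2} ∪
    {e | ∃ c, (1, c) ∉ coveredSet M₀ ∧ e = s((1, c), f c)}, ⟨?_, ?_⟩, ?_, ?_, ?_, ?_⟩
  · rintro e (he | ⟨c, hc, rfl⟩)
    · exact hM₀.1 he.1
    · exact (hf c hc).2
  · rintro e (he | ⟨c, hc, rfl⟩) e' (he' | ⟨d, hd, rfl⟩) hne v hv hv'
    · exact hM₀.2 he.1 he'.1 hne v hv hv'
    · exact hdisj d hd e he.1 v hv' hv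
    · exact hdisj c hc e' he'.1 v hv hv'
    · rcases Sym2.mem_iff.1 hv with rfl | rfl <;> rcases Sym2.mem_iff.1 hv' with h | h
      · exact hne (by rw [show c = d from (Prod.ext_iff.1 h).2])
      · exact hne (by rw [← h, hsymm d c h.symm, Sym2.eq_swap])
      · exact hne (by rw [h, hsymm c d h, Sym2.eq_swap])
      · exact hne (by rw [hinj h])
  · rintro e (he | ⟨c, hc, rfl⟩) v hv
    · exact he.2 v hv
    · rcases Sym2.mem_iff.1 hv with rfl | rfl
      · exact .inr (.inl rfl)
      · exact hrow c hc
  · exact fun e he hJ => .inl ⟨he, hJ⟩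
  · rintro ⟨r, c⟩ rfl
    by_cases hc : ((1, c) : ZMod 6 × Fin n) ∈ coveredSet M₀
    · obtain ⟨e, he, hce⟩ := hc
      obtain ⟨q, rfl⟩ := hce
      refine ⟨_, .inl ⟨he, fun v hv => ?_⟩, Sym2.mem_mk_left _ _⟩
      rcases Sym2.mem_iff.1 hv with rfl | rfl
      · exact .inr (.inl rfl)
      · exact bowTie.row_of_adj_row_one (hM₀.1 he)
    · exact ⟨_, .inr ⟨c, hc, rfl⟩, Sym2.mem_mk_left _ _⟩
  · rintro p hp hpM e (he | ⟨c, hc, rfl⟩) hpe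
    · have heq : e = s(p, (-1 - p.1, p.2)) := by
        by_contra hne
        exact hM₀.2 he.1 hpM hne p hpe (Sym2.mem_mk_left _ _)
      have key : ∀ r : ZMod 6, (r = 0 ∨ r = 2) →
          ¬ (-1 - r = 0 ∨ -1 - r = 1 ∨ -1 - r = 2) := by decide
      exact key p.1 hp (he.2 (-1 - p.1, p.2) (heq ▸ Sym2.mem_mk_right _ _))
    · exact hdisj c hc _ hpM p hpe (Sym2.mem_mk_left _ _)
end

section
/- Let n ≥ 5 be an odd integer and let B_n be the graph with vertex set H ∪ Q, where H = {h_1,…,h_n} (indices mod n) and Q = {q_1,…,q_{2n}} (indices mod 2n), whose edges are h_i h_{i+1} for all i, q_j q_{j+1} for all j, and h_i q_i and h_i q_{i+n} for all i ∈ {1,…,n}. Then for every edge e of B_n and every vertex q_k ∈ Q not incident to e, the graph obtained from B_n by deleting both ends of e and the vertex q_k has a perfect matching. -/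
open SimpleGraph

/-- The vertices in `S` are perfectly matched among themselves by some matching of `G`. -/
def Matchable {V : Type*} (G : SimpleGraph V) (S : Set V) : Prop :=
  ∃ M, IsMatchingSet G M ∧ (∀ f ∈ M, ∀ v ∈ f, v ∈ S) ∧ ∀ v ∈ S, ∃ f ∈ M, v ∈ f

namespace Matchable

variable {V W : Type*} {G : SimpleGraph V} {S T : Set V}

lemma empty (G : SimpleGraph V) : Matchable G ∅ :=
  ⟨∅, ⟨by simp, by simp⟩, by simp, by simp⟩

lemma pair {u v : V} (h : G.Adj u v) : Matchable G {u, v} := by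
  refine ⟨{s(u, v)}, ⟨by simpa using h, by simp⟩, by simp, ?_⟩
  intro w hw
  exact ⟨s(u, v), rfl, by simpa using hw⟩

lemma union (hS : Matchable G S) (hT : Matchable G T) (hST : Disjoint S T) :
    Matchable G (S ∪ T) := by
  obtain ⟨M, ⟨hM, hMp⟩, hMS, hMc⟩ := hS
  obtain ⟨N, ⟨hN, hNp⟩, hNT, hNc⟩ := hT
  rw [Set.disjoint_left] at hST
  refine ⟨M ∪ N, ⟨Set.union_subset hM hN, ?_⟩, ?_, ?_⟩
  · rintro f (hf | hf) g (hg | hg) hfg v hvf hvg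
    · exact hMp hf hg hfg v hvf hvg
    · exact hST (hMS f hf v hvf) (hNT g hg v hvg)
    · exact hST (hMS g hg v hvg) (hNT f hf v hvf)
    · exact hNp hf hg hfg v hvf hvg
  · rintro f (hf | hf) v hv
    · exact Or.inl (hMS f hf v hv)
    · exact Or.inr (hNT f hf v hv)
  · rintro v (hv | hv)
    · obtain ⟨f, hf, hvf⟩ := hMc v hv
      exact ⟨f, Or.inl hf, hvf⟩
    · obtain ⟨f, hf, hvf⟩ := hNc v hv
      exact ⟨f, Or.inr hf, hvf⟩

lemma image_of_comap {G : SimpleGraph W} {φ : V → W} (h : Matchable (G.comap φ) S)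
    (hφ : Set.InjOn φ S) : Matchable G (φ '' S) := by
  obtain ⟨M, ⟨hM, hMp⟩, hMS, hMc⟩ := h
  refine ⟨Sym2.map φ '' M, ⟨?_, ?_⟩, ?_, ?_⟩
  · rintro _ ⟨f, hf, rfl⟩
    have := hM hf
    induction f with | _ u v => simpa using this
  · rintro _ ⟨f, hf, rfl⟩ _ ⟨g, hg, rfl⟩ hfg w hwf hwg
    obtain ⟨u, hu, rfl⟩ := Sym2.mem_map.1 hwf
    obtain ⟨v, hv, huv⟩ := Sym2.mem_map.1 hwg
    obtain rfl := hφ (hMS g hg v hv) (hMS f hf u hu) huv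
    exact hMp hf hg (fun h => hfg (congrArg _ h)) v hu hv
  · rintro _ ⟨f, hf, rfl⟩ w hw
    obtain ⟨u, hu, rfl⟩ := Sym2.mem_map.1 hw
    exact ⟨u, hMS f hf u hu, rfl⟩
  · rintro _ ⟨v, hv, rfl⟩
    obtain ⟨f, hf, hvf⟩ := hMc v hv
    exact ⟨_, ⟨f, hf, rfl⟩, Sym2.mem_map.2 ⟨v, hvf, rfl⟩⟩

lemma image_Ico {c : ℕ → V} (hc : Function.Injective c) (hadj : ∀ t, G.Adj (c t) (c (t + 1)))
    {a b : ℕ} (hab : Even (b - a)) : Matchable G (c '' Set.Ico a b) := by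
  obtain ⟨l, hl⟩ := hab
  induction l generalizing a with
  | zero =>
    rw [Set.Ico_eq_empty (by omega), Set.image_empty]
    exact empty G
  | succ l ih =>
    have hS : c '' Set.Ico a b = {c a, c (a + 1)} ∪ c '' Set.Ico (a + 2) b := by
      rw [← Set.image_pair, ← Set.image_union]
      congr 1
      ext t
      simp only [Set.mem_Ico, Set.mem_union, Set.mem_insert_iff, Set.mem_singleton_iff]
      omega
    rw [hS]
    refine (pair (hadj a)).union (ih (by omega)) ?_
    rw [← Set.image_pair, Set.disjoint_image_iff hc, Set.disjoint_left]
    intro t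
    simp only [Set.mem_Ico, Set.mem_insert_iff, Set.mem_singleton_iff]
    omega

end Matchable

lemma ZMod.add_natCast_injOn {m : ℕ} (a : ZMod m) :
    Set.InjOn (fun t : ℕ => a + (t : ZMod m)) (Set.Iio m) := by
  intro s hs t ht h
  have h' := (ZMod.natCast_eq_natCast_iff' _ _ _).1 (add_left_cancel h)
  rwa [Nat.mod_eq_of_lt hs, Nat.mod_eq_of_lt ht] at h'

lemma ZMod.exists_lt_eq_add_natCast {m : ℕ} [NeZero m] (a b : ZMod m) :
    ∃ t < m, b = a + (t : ZMod m) :=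
  ⟨(b - a).val, ZMod.val_lt _, by simp⟩

/-- Coordinates on the vertices of `B_n`, counted from `h_i` and from `q_k`. -/
def bCoord (n : ℕ) (i : ZMod n) (k : ZMod (2 * n)) : ℕ ⊕ ℕ → ZMod n ⊕ ZMod (2 * n) :=
  Sum.map (fun s => i + s) (fun t => k + t)

/-- The pull-back of `B_n` along `bCoord`. -/
abbrev bCoordGraph (n : ℕ) (i : ZMod n) (k : ZMod (2 * n)) : SimpleGraph (ℕ ⊕ ℕ) :=
  (Bgraph n).comap (bCoord n i k)

section Coordinates

variable {n : ℕ} {i : ZMod n} {k : ZMod (2 * n)}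

lemma bCoordGraph_adj_inl (hn : 5 ≤ n) (s : ℕ) :
    (bCoordGraph n i k).Adj (Sum.inl s) (Sum.inl (s + 1)) := by
  have : Fact (1 < n) := ⟨by omega⟩
  simp [bCoord, Bgraph, bRel, SimpleGraph.fromRel_adj, add_assoc]

lemma bCoordGraph_adj_inr (hn : 5 ≤ n) (t : ℕ) :
    (bCoordGraph n i k).Adj (Sum.inr t) (Sum.inr (t + 1)) := by
  have : Fact (1 < 2 * n) := ⟨by omega⟩
  simp [bCoord, Bgraph, bRel, SimpleGraph.fromRel_adj, add_assoc]

lemma natCast_val_eq_cast (hn : 5 ≤ n) (j : ZMod (2 * n)) : (j.val : ZMod n) = j.cast := by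
  have : NeZero (2 * n) := ⟨by omega⟩
  exact ZMod.natCast_val j

lemma bCoordGraph_adj_inl_inr (hn : 5 ≤ n) {s t : ℕ} (h : i + s = (k.cast + t : ZMod n)) :
    (bCoordGraph n i k).Adj (Sum.inl s) (Sum.inr t) := by
  have h2 : n ∣ 2 * n := Dvd.intro_left 2 rfl
  simp only [SimpleGraph.comap_adj, bCoord, Bgraph, SimpleGraph.fromRel_adj, Sum.map_inl,
    Sum.map_inr, bRel, natCast_val_eq_cast hn, ZMod.cast_add h2, ZMod.cast_natCast h2]
  exact ⟨by simp, Or.inl h⟩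

lemma matchable_inl_Ico (hn : 5 ≤ n) {a b : ℕ} (hab : Even (b - a)) :
    Matchable (bCoordGraph n i k) (Sum.inl '' Set.Ico a b) :=
  Matchable.image_Ico Sum.inl_injective (bCoordGraph_adj_inl hn) hab

lemma matchable_inr_Ico (hn : 5 ≤ n) {a b : ℕ} (hab : Even (b - a)) :
    Matchable (bCoordGraph n i k) (Sum.inr '' Set.Ico a b) :=
  Matchable.image_Ico Sum.inr_injective (bCoordGraph_adj_inr hn) hab

/-- The coordinates of the vertices of `B_n`, each vertex having exactly one. -/
def bBox (n : ℕ) : Set (ℕ ⊕ ℕ) := Sum.inl '' Set.Iio n ∪ Sum.inr '' Set.Iio (2 * n)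

lemma bCoord_injOn : Set.InjOn (bCoord n i k) (bBox n) := by
  rintro _ (⟨s, hs, rfl⟩ | ⟨s, hs, rfl⟩) _ (⟨t, ht, rfl⟩ | ⟨t, ht, rfl⟩) h
  · exact congrArg _ (ZMod.add_natCast_injOn i hs ht (Sum.inl_injective h))
  · simp [bCoord] at h
  · simp [bCoord] at h
  · exact congrArg _ (ZMod.add_natCast_injOn k hs ht (Sum.inr_injective h))

lemma exists_bCoord_eq (hn : 5 ≤ n) (i : ZMod n) (k : ZMod (2 * n))
    (v : ZMod n ⊕ ZMod (2 * n)) : ∃ x ∈ bBox n, bCoord n i k x = v := by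
  have : NeZero n := ⟨by omega⟩
  have : NeZero (2 * n) := ⟨by omega⟩
  rcases v with v | v
  · obtain ⟨t, ht, rfl⟩ := ZMod.exists_lt_eq_add_natCast i v
    exact ⟨_, Or.inl ⟨t, ht, rfl⟩, rfl⟩
  · obtain ⟨t, ht, rfl⟩ := ZMod.exists_lt_eq_add_natCast k v
    exact ⟨_, Or.inr ⟨t, ht, rfl⟩, rfl⟩

lemma matchable_Bgraph_of_coords (hn : 5 ≤ n) {x y : ℕ ⊕ ℕ} (hx : x ∈ bBox n) (hy : y ∈ bBox n)
    {T : Set (ℕ ⊕ ℕ)} (hT : Matchable (bCoordGraph n i k) T)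
    (hTeq : T = bBox n \ {x, y, Sum.inr 0}) :
    Matchable (Bgraph n) {v | v ∉ s(bCoord n i k x, bCoord n i k y) ∧ v ≠ Sum.inr k} := by
  subst hTeq
  have h0 : Sum.inr 0 ∈ bBox n := Or.inr ⟨0, by simp; omega, rfl⟩
  have hk : (Sum.inr k : ZMod n ⊕ ZMod (2 * n)) = bCoord n i k (Sum.inr 0) := by simp [bCoord]
  convert hT.image_of_comap (bCoord_injOn.mono Set.sdiff_subset) using 1
  rw [bCoord_injOn.image_sdiff_subset
    (by simp [Set.insert_subset_iff, hx, hy, h0]), Set.image_insert_eq, Set.image_pair]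
  ext v
  obtain ⟨z, hz, hzv⟩ := exists_bCoord_eq hn i k v
  have hv : v ∈ bCoord n i k '' bBox n := ⟨z, hz, hzv⟩
  simp only [Set.mem_ofPred_eq, Sym2.mem_iff, Set.mem_sdiff, hv, hk, Set.mem_insert_iff,
    Set.mem_singleton_iff]
  tauto

end Coordinates

/-- The case where a spoke is deleted. -/
lemma matchable_delete_spoke {n : ℕ} (hn : 5 ≤ n) (hno : Odd n) (k : ZMod (2 * n)) {t : ℕ}
    (ht : 0 < t) (ht2 : t < 2 * n) :
    Matchable (Bgraph n) {v | v ∉ s(bCoord n (k.cast + t) k (Sum.inl 0),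
      bCoord n (k.cast + t) k (Sum.inr t)) ∧ v ≠ Sum.inr k} := by
  have hx : Sum.inl 0 ∈ bBox n := by simp [bBox]; omega
  have hy : Sum.inr t ∈ bBox n := by simpa [bBox] using ht2
  rcases Nat.even_or_odd t with he | ho
  · have h1 : (bCoordGraph n (k.cast + t) k).Adj (Sum.inl (n - 1)) (Sum.inr (t - 1)) := by
      apply bCoordGraph_adj_inl_inr hn
      rw [Nat.cast_sub (by omega), Nat.cast_sub (by omega)]
      simp
      ring
    have h2 : (bCoordGraph n (k.cast + t) k).Adj (Sum.inl 1) (Sum.inr (t + 1)) := by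
      apply bCoordGraph_adj_inl_inr hn
      push_cast
      ring
    refine matchable_Bgraph_of_coords hn hx hy
      (((((Matchable.pair h1).union (Matchable.pair h2) ?_).union
      (matchable_inl_Ico hn (a := 2) (b := n - 1) ?_) ?_).union
      (matchable_inr_Ico hn (a := 1) (b := t - 1) ?_) ?_).union
      (matchable_inr_Ico hn (a := t + 2) (b := 2 * n) ?_) ?_) ?_
    all_goals first
      | grind
      | (ext (s | s) <;> simp [bBox] <;> grind)
  · refine matchable_Bgraph_of_coords hn hx hy
      (((matchable_inl_Ico hn (a := 1) (b := n) ?_).union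
      (matchable_inr_Ico hn (a := 1) (b := t) ?_) ?_).union
      (matchable_inr_Ico hn (a := t + 1) (b := 2 * n) ?_) ?_) ?_
    all_goals first
      | grind
      | (ext (s | s) <;> simp [bBox] <;> grind)

/-- The case where an edge of the cycle on `H` is deleted. -/
lemma matchable_delete_inl_edge {n : ℕ} (hn : 5 ≤ n) (hno : Odd n) (i : ZMod n)
    (k : ZMod (2 * n)) :
    Matchable (Bgraph n) {v | v ∉ s(bCoord n i k (Sum.inl (n - 2)),
      bCoord n i k (Sum.inl (n - 1))) ∧ v ≠ Sum.inr k} := by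
  have hx : Sum.inl (n - 2) ∈ bBox n := by simp [bBox]; omega
  have hy : Sum.inl (n - 1) ∈ bBox n := by simp [bBox]; omega
  have : NeZero n := ⟨by omega⟩
  obtain ⟨a, ha, hao, hia⟩ : ∃ a < 2 * n, Odd a ∧ i = (k.cast + a : ZMod n) := by
    obtain ⟨t, ht, hit⟩ := ZMod.exists_lt_eq_add_natCast (k.cast : ZMod n) i
    rcases Nat.even_or_odd t with he | ho
    · exact ⟨t + n, by omega, he.add_odd hno, by simpa using hit⟩
    · exact ⟨t, by omega, ho, hit⟩
  have h1 : (bCoordGraph n i k).Adj (Sum.inl 0) (Sum.inr a) :=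
    bCoordGraph_adj_inl_inr hn (by simpa using hia)
  refine matchable_Bgraph_of_coords hn hx hy
    ((((Matchable.pair h1).union
    (matchable_inl_Ico hn (a := 1) (b := n - 2) ?_) ?_).union
    (matchable_inr_Ico hn (a := 1) (b := a) ?_) ?_).union
    (matchable_inr_Ico hn (a := a + 1) (b := 2 * n) ?_) ?_) ?_
  all_goals first
    | grind
    | (ext (s | s) <;> simp [bBox] <;> grind)

/-- The case where an edge of the cycle on `Q` is deleted. -/
lemma matchable_delete_inr_edge {n : ℕ} (hn : 5 ≤ n) (hno : Odd n) (k : ZMod (2 * n)) {t : ℕ}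
    (ht : 0 < t) (ht2 : t + 1 < 2 * n) (i : ZMod n) :
    Matchable (Bgraph n) {v | v ∉ s(bCoord n i k (Sum.inr t),
      bCoord n i k (Sum.inr (t + 1))) ∧ v ≠ Sum.inr k} := by
  have hx : Sum.inr t ∈ bBox n := by simp [bBox]; omega
  have hy : Sum.inr (t + 1) ∈ bBox n := by simpa [bBox] using ht2
  obtain ⟨a, ha⟩ : ∃ a : ℕ, a = if Even t then 1 else 2 * n - 1 := ⟨_, rfl⟩
  change Matchable (Bgraph n) {v | v ∉ s(bCoord n (k.cast + a) k (Sum.inr t),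
    bCoord n (k.cast + a) k (Sum.inr (t + 1))) ∧ v ≠ Sum.inr k}
  have h1 : (bCoordGraph n (k.cast + a) k).Adj (Sum.inl 0) (Sum.inr a) :=
    bCoordGraph_adj_inl_inr hn (by simp)
  rcases Nat.even_or_odd t with he | ho
  · refine matchable_Bgraph_of_coords hn hx hy
      ((((Matchable.pair h1).union
      (matchable_inl_Ico hn (a := 1) (b := n) ?_) ?_).union
      (matchable_inr_Ico hn (a := 2) (b := t) ?_) ?_).union
      (matchable_inr_Ico hn (a := t + 2) (b := 2 * n) ?_) ?_) ?_
    all_goals first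
      | grind
      | (ext (s | s) <;> simp [bBox] <;> grind)
  · refine matchable_Bgraph_of_coords hn hx hy
      ((((Matchable.pair h1).union
      (matchable_inl_Ico hn (a := 1) (b := n) ?_) ?_).union
      (matchable_inr_Ico hn (a := 1) (b := t) ?_) ?_).union
      (matchable_inr_Ico hn (a := t + 2) (b := 2 * n - 1) ?_) ?_) ?_
    all_goals first
      | grind
      | (ext (s | s) <;> simp [bBox] <;> grind)

lemma matchable_delete_of_bRel {n : ℕ} (hn : 5 ≤ n) (hno : Odd n) {u v : ZMod n ⊕ ZMod (2 * n)}
    (huv : bRel n u v) {k : ZMod (2 * n)} (hu : u ≠ Sum.inr k) (hv : v ≠ Sum.inr k) :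
    Matchable (Bgraph n) {w | w ∉ s(u, v) ∧ w ≠ Sum.inr k} := by
  have : NeZero (2 * n) := ⟨by omega⟩
  have h2 : n ∣ 2 * n := Dvd.intro_left 2 rfl
  rcases u with u | u <;> rcases v with v | v
  · obtain rfl : v = u + 1 := huv
    have h := matchable_delete_inl_edge hn hno (u + 2) k
    have hu' : u + 2 + ((n - 2 : ℕ) : ZMod n) = u := by
      rw [Nat.cast_sub (by omega), ZMod.natCast_self]
      push_cast
      ring
    have hv' : u + 2 + ((n - 1 : ℕ) : ZMod n) = u + 1 := by
      rw [Nat.cast_sub (by omega), ZMod.natCast_self]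
      push_cast
      ring
    simpa only [bCoord, Sum.map_inl, hu', hv'] using h
  · obtain rfl : u = (v.val : ZMod n) := huv
    obtain ⟨t, ht, rfl⟩ := ZMod.exists_lt_eq_add_natCast k v
    have ht0 : 0 < t := by
      rcases Nat.eq_zero_or_pos t with rfl | h
      · simp at hv
      · exact h
    convert matchable_delete_spoke hn hno k ht0 ht using 6
    rw [natCast_val_eq_cast hn, ZMod.cast_add h2, ZMod.cast_natCast h2]
    simp [bCoord]
  · exact huv.elim
  · obtain rfl : v = u + 1 := huv
    obtain ⟨t, ht, rfl⟩ := ZMod.exists_lt_eq_add_natCast k u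
    have ht0 : 0 < t := by
      rcases Nat.eq_zero_or_pos t with rfl | h
      · simp at hu
      · exact h
    have ht2 : t + 1 < 2 * n := by
      by_contra h
      obtain h : t + 1 = 2 * n := by omega
      apply hv
      rw [add_assoc, ← Nat.cast_add_one, h, ZMod.natCast_self, add_zero]
    convert matchable_delete_inr_edge hn hno k ht0 ht2 0 using 6
    simp [bCoord, add_assoc]

/-- for odd `n ≥ 5`, for every edge `e` of `B_n` and every vertex
`q_k ∈ Q` not incident to `e`, the graph obtained from `B_n` by deleting both ends of
`e` and the vertex `q_k` has a perfect matching (i.e. `B_n` has a matching avoiding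
the three deleted vertices and covering all remaining vertices). -/
theorem Bgraph_delete_edge_and_vertex_perfect_matching (n : ℕ) (hn : 5 ≤ n) (hno : Odd n)
    (e : Sym2 (ZMod n ⊕ ZMod (2 * n))) (he : e ∈ (Bgraph n).edgeSet)
    (k : ZMod (2 * n)) (hk : (Sum.inr k : ZMod n ⊕ ZMod (2 * n)) ∉ e) :
    ∃ M, IsMatchingSet (Bgraph n) M ∧
      (∀ f ∈ M, ∀ v ∈ f, v ∉ e ∧ v ≠ (Sum.inr k : ZMod n ⊕ ZMod (2 * n))) ∧
      (∀ v : ZMod n ⊕ ZMod (2 * n), v ∉ e → v ≠ Sum.inr k → ∃ f ∈ M, v ∈ f) := by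
  suffices h : Matchable (Bgraph n) {v | v ∉ e ∧ v ≠ Sum.inr k} by
    obtain ⟨M, hM, hMS, hMc⟩ := h
    exact ⟨M, hM, hMS, fun v hve hvk => hMc v ⟨hve, hvk⟩⟩
  induction e with | _ u v
  rw [Sym2.mem_iff, not_or] at hk
  obtain ⟨-, h | h⟩ := (SimpleGraph.fromRel_adj _ _ _).1 ((Bgraph n).mem_edgeSet.1 he)
  · exact matchable_delete_of_bRel hn hno h (Ne.symm hk.1) (Ne.symm hk.2)
  · rw [Sym2.eq_swap]
    exact matchable_delete_of_bRel hn hno h (Ne.symm hk.2) (Ne.symm hk.1)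
end

section
/- Let n ≥ 5 be an odd integer and let B_n be the graph with vertex set H ∪ Q, where H = {h_1,…,h_n} (indices mod n) and Q = {q_1,…,q_{2n}} (indices mod 2n), whose edges are h_i h_{i+1} for all i, q_j q_{j+1} for all j, and h_i q_i and h_i q_{i+n} for all i ∈ {1,…,n}. Let e_0 be any edge of the cycle induced by Q. Then every 2-matching of B_n is contained in a matching of B_n that covers all vertices of B_n except exactly one, and in particular covers every vertex of H and both ends of e_0. -/
open SimpleGraph

/-- The successor on the cyclically ordered set `{0, …, n - 1}`. -/
def cycSucc (n a : ℕ) : ℕ := if a + 1 = n then 0 else a + 1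

/-- Names for the edges of `B_n`: `hh a` is `h_a h_{a+1}`, `qq b` is `q_b q_{b+1}` and
`sp b` is the spoke at `q_b`. -/
inductive BEdge
  | hh (a : ℕ)
  | qq (b : ℕ)
  | sp (b : ℕ)

namespace BEdge

/-- The index of an edge. -/
def pos : BEdge → ℕ
  | hh a => a
  | qq b => b
  | sp b => b

/-- The number of edges of the same kind. -/
def size (n : ℕ) : BEdge → ℕ
  | hh _ => n
  | qq _ => 2 * n
  | sp _ => 2 * n

/-- The edge is incident with `h_v`. -/
def IncH (n : ℕ) : BEdge → ℕ → Prop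
  | hh a, v => v = a ∨ v = cycSucc n a
  | qq _, _ => False
  | sp b, v => b = v ∨ b = v + n

/-- The edge is incident with `q_v`. -/
def IncQ (n : ℕ) : BEdge → ℕ → Prop
  | hh _, _ => False
  | qq b, v => v = b ∨ v = cycSucc (2 * n) b
  | sp b, v => v = b

instance (n : ℕ) (e : BEdge) (v : ℕ) : Decidable (e.IncH n v) := by
  cases e <;> unfold IncH <;> infer_instance

instance (n : ℕ) (e : BEdge) (v : ℕ) : Decidable (e.IncQ n v) := by
  cases e <;> unfold IncQ <;> infer_instance

/-- The edges have no common vertex. -/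
def Disj (n : ℕ) (e f : BEdge) : Prop :=
  (∀ v < n, ¬ (e.IncH n v ∧ f.IncH n v)) ∧ ∀ v < 2 * n, ¬ (e.IncQ n v ∧ f.IncQ n v)

instance (n : ℕ) (e f : BEdge) : Decidable (e.Disj n f) := by
  unfold Disj; infer_instance

/-- The value at an edge of a function on edges given by its three restrictions. -/
def val (x y s : ℕ → ℕ) : BEdge → ℕ
  | hh a => x a
  | qq b => y b
  | sp b => s b

/-- Rotate the graph by one step. -/
def rot (n : ℕ) : BEdge → BEdge
  | hh a => hh (cycSucc n a)
  | qq b => qq (cycSucc (2 * n) b)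
  | sp b => sp (cycSucc (2 * n) b)

/-- The edge avoids the columns `c` and `c + 1`. -/
def Avoids (n c : ℕ) : BEdge → Prop
  | hh a => a + 1 < c ∨ c + 2 ≤ a
  | qq b => b + 1 < c ∨ c + 2 ≤ b ∧ b + 1 < c + n ∨ c + n + 2 ≤ b
  | sp b => b < c ∨ c + 2 ≤ b ∧ b < c + n ∨ c + n + 2 ≤ b

/-- The edge of `B_{n-2}` obtained by deleting the columns `c` and `c + 1`. -/
def collapse (n c : ℕ) : BEdge → BEdge
  | hh a => hh (if a < c then a else a - 2)
  | qq b => qq (if b < c then b else if b < c + n then b - 2 else b - 4)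
  | sp b => sp (if b < c then b else if b < c + n then b - 2 else b - 4)

end BEdge

open BEdge

/-- The indicator functions `x`, `y`, `s` describe a near perfect matching of `B_n` that
misses only `q_w`. -/
def IsNearPerfect (n : ℕ) (x y s : ℕ → ℕ) (w : ℕ) : Prop :=
  (∀ a < n, x a + x (cycSucc n a) + s (cycSucc n a) + s (cycSucc n a + n) = 1) ∧
  (∀ b < 2 * n, y b + y (cycSucc (2 * n) b) + s (cycSucc (2 * n) b) +
    (if cycSucc (2 * n) b = w then 1 else 0) = 1) ∧ w < 2 * n

instance (n : ℕ) (x y s : ℕ → ℕ) (w : ℕ) : Decidable (IsNearPerfect n x y s w) := by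
  unfold IsNearPerfect; infer_instance

/-- Some near perfect matching of `B_n` contains `e` and `f` and misses a vertex of `Q` other than
`q_j` and `q_{j+1}`. -/
def Extends (n : ℕ) (e f : BEdge) (j : ℕ) : Prop :=
  ∃ x y s w, IsNearPerfect n x y s w ∧ e.val x y s = 1 ∧ f.val x y s = 1 ∧
    w ≠ j ∧ w ≠ cycSucc (2 * n) j

lemma cycSucc_lt {n a : ℕ} (h : a < n) : cycSucc n a < n := by
  unfold cycSucc; split <;> omega

lemma cycSucc_of_lt {n a : ℕ} (h : a + 1 < n) : cycSucc n a = a + 1 :=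
  if_neg h.ne

lemma cycSucc_of_eq {n a : ℕ} (h : a + 1 = n) : cycSucc n a = 0 :=
  if_pos h

lemma BEdge.pos_rot_lt {n : ℕ} {e : BEdge} (h : e.pos < e.size n) :
    (e.rot n).pos < (e.rot n).size n := by
  cases e <;> exact cycSucc_lt h

lemma BEdge.Disj.rot {n : ℕ} {e f : BEdge} (he : e.pos < e.size n)
    (hf : f.pos < f.size n) (h : e.Disj n f) : (e.rot n).Disj n (f.rot n) := by
  obtain ⟨hH, hQ⟩ := h
  constructor
  · intro v hv
    have := hH (if v = 0 then n - 1 else v - 1) (by split <;> omega)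
    revert this
    cases e <;> cases f <;> simp only [BEdge.rot, IncH, pos, size, cycSucc] at * <;> grind
  · intro v hv
    have := hQ (if v = 0 then 2 * n - 1 else v - 1) (by split <;> omega)
    revert this
    cases e <;> cases f <;> simp only [BEdge.rot, IncQ, pos, size, cycSucc] at * <;> grind

lemma Extends.of_rot {n : ℕ} (hn : 1 < n) {e f : BEdge} {j : ℕ} (hj : j < 2 * n)
    (h : Extends n (e.rot n) (f.rot n) (cycSucc (2 * n) j)) : Extends n e f j := by
  obtain ⟨x, y, s, w, ⟨hH, hQ, hw⟩, he, hf, h1, h2⟩ := h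
  refine ⟨fun a => x (cycSucc n a), fun b => y (cycSucc (2 * n) b),
    fun b => s (cycSucc (2 * n) b), if w = 0 then 2 * n - 1 else w - 1, ⟨?_, ?_, ?_⟩, ?_, ?_, ?_, ?_⟩
  · intro a ha
    have h := hH _ (cycSucc_lt ha)
    have : cycSucc (2 * n) (cycSucc n a) = cycSucc n (cycSucc n a) ∧
          cycSucc (2 * n) (cycSucc n a + n) = cycSucc n (cycSucc n a) + n ∨
        cycSucc (2 * n) (cycSucc n a) = cycSucc n (cycSucc n a) + n ∧
          cycSucc (2 * n) (cycSucc n a + n) = cycSucc n (cycSucc n a) := by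
      unfold cycSucc
      split_ifs <;> omega
    rcases this with ⟨h3, h4⟩ | ⟨h3, h4⟩ <;> simp only [h3, h4] <;> omega
  · intro b hb
    have h := hQ _ (cycSucc_lt hb)
    have : cycSucc (2 * n) b = (if w = 0 then 2 * n - 1 else w - 1) ↔
        cycSucc (2 * n) (cycSucc (2 * n) b) = w := by
      unfold cycSucc
      split_ifs <;> omega
    simpa only [this] using h
  · split <;> omega
  · cases e <;> exact he
  · cases f <;> exact hf
  · unfold cycSucc at h1
    split_ifs at * <;> omega
  · unfold cycSucc at *
    split_ifs at * <;> omega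

/-- Rotating, one may assume that the first edge has index `0`. -/
lemma extends_of_pos_eq_zero {n : ℕ} (hn : 1 < n)
    (h : ∀ (e f : BEdge) (j : ℕ), e.pos = 0 → f.pos < f.size n → j < 2 * n → e.Disj n f →
      Extends n e f j) (k : ℕ) (e f : BEdge) (j : ℕ) (he : e.pos < e.size n)
    (hf : f.pos < f.size n) (hj : j < 2 * n) (hd : e.Disj n f)
    (hk : e.pos = 0 ∨ e.pos + k = e.size n) : Extends n e f j := by
  induction k generalizing e f j with
  | zero => exact h e f j (by omega) hf hj hd
  | succ k ih =>
    rcases hk with hk | hk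
    · exact h e f j hk hf hj hd
    · refine .of_rot hn hj (ih _ _ _ (pos_rot_lt he) (pos_rot_lt hf) (cycSucc_lt hj)
        (hd.rot he hf) ?_)
      cases e <;> simp only [BEdge.rot, pos, size, cycSucc] at * <;> grind

/-- Rotating, one may assume that `j = 0`. -/
lemma extends_of_eq_zero {n : ℕ} (hn : 1 < n)
    (h : ∀ e f : BEdge, e.pos < e.size n → f.pos < f.size n → e.Disj n f → Extends n e f 0)
    (k : ℕ) (e f : BEdge) (j : ℕ) (he : e.pos < e.size n)
    (hf : f.pos < f.size n) (hj : j < 2 * n) (hd : e.Disj n f)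
    (hk : j = 0 ∨ j + k = 2 * n) : Extends n e f j := by
  induction k generalizing e f j with
  | zero => obtain rfl : j = 0 := by omega
            exact h e f he hf hd
  | succ k ih =>
    rcases hk with rfl | hk
    · exact h e f he hf hd
    · refine .of_rot hn hj (ih _ _ _ (pos_rot_lt he) (pos_rot_lt hf) (cycSucc_lt hj)
        (hd.rot he hf) ?_)
      unfold cycSucc
      grind

lemma BEdge.pos_collapse_lt {n c : ℕ} (hc : 0 < c) (hcn : c ≤ n) {e : BEdge}
    (he : e.pos < e.size (n + 2)) (h : e.Avoids (n + 2) c) :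
    (e.collapse (n + 2) c).pos < (e.collapse (n + 2) c).size n := by
  cases e <;> simp only [collapse, Avoids, pos, size] at * <;> grind

lemma BEdge.incH_of_collapse {n c : ℕ} (hc : 0 < c) (hcn : c ≤ n) {e : BEdge}
    (he : e.pos < e.size (n + 2)) (h : e.Avoids (n + 2) c) {v : ℕ} (hv : v < n)
    (hi : (e.collapse (n + 2) c).IncH n v) : e.IncH (n + 2) (if v < c then v else v + 2) := by
  cases e <;> simp only [collapse, Avoids, IncH, pos, size, cycSucc] at * <;> grind

lemma BEdge.incQ_of_collapse {n c : ℕ} (hc : 0 < c) (hcn : c ≤ n) {e : BEdge}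
    (he : e.pos < e.size (n + 2)) (h : e.Avoids (n + 2) c) {v : ℕ} (hv : v < 2 * n)
    (hi : (e.collapse (n + 2) c).IncQ n v) :
    e.IncQ (n + 2) (if v < c then v else if v < c + n then v + 2 else v + 4) := by
  cases e <;> simp only [collapse, Avoids, IncQ, pos, size, cycSucc] at * <;> grind

lemma BEdge.Disj.collapse {n c : ℕ} (hc : 0 < c) (hcn : c ≤ n) {e f : BEdge}
    (he : e.pos < e.size (n + 2)) (hf : f.pos < f.size (n + 2)) (hce : e.Avoids (n + 2) c)
    (hcf : f.Avoids (n + 2) c) (h : e.Disj (n + 2) f) :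
    (e.collapse (n + 2) c).Disj n (f.collapse (n + 2) c) :=
  ⟨fun v hv hi => h.1 _ (by split <;> omega)
    ⟨incH_of_collapse hc hcn he hce hv hi.1, incH_of_collapse hc hcn hf hcf hv hi.2⟩,
   fun v hv hi => h.2 _ (by split_ifs <;> omega)
    ⟨incQ_of_collapse hc hcn he hce hv hi.1, incQ_of_collapse hc hcn hf hcf hv hi.2⟩⟩

/-- A near perfect matching of `B_n` can be expanded by two new columns. -/
lemma Extends.of_collapse {n c : ℕ} (hc : 0 < c) (hcn : c ≤ n) {e f : BEdge} {j : ℕ}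
    (hj : j < 2 * (n + 2)) (hce : e.Avoids (n + 2) c) (hcf : f.Avoids (n + 2) c)
    (h : Extends n (e.collapse (n + 2) c) (f.collapse (n + 2) c)
      (if j < c then j else if j < c + n + 2 then max (c - 1) (j - 2)
        else max (c + n - 1) (j - 4))) :
    Extends (n + 2) e f j := by
  obtain ⟨x, y, s, w, ⟨hH, hQ, hw⟩, he, hf, h1, h2⟩ := h
  refine ⟨fun a => if a < c then x a else if a = c then 1 - x (c - 1) else x (a - 2),
    fun b => if b < c then y b else if b = c then 1 - y (c - 1) else if b < c + n + 2 then y (b - 2)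
      else if b = c + n + 2 then 1 - y (c + n - 1) else y (b - 4),
    fun b => if b < c then s b else if b < c + 2 then 0 else if b < c + n + 2 then s (b - 2)
      else if b < c + n + 4 then 0 else s (b - 4),
    if w < c then w else if w < c + n then w + 2 else w + 4, ⟨?_, ?_, ?_⟩, ?_, ?_, ?_, ?_⟩
  · intro a ha
    clear hQ h1 h2 he hf hce hcf hj hw
    obtain h | h | h | h | h : a + 1 < c ∨ a + 1 = c ∨ a = c ∨ c + 1 ≤ a ∧ a < n + 1 ∨ a = n + 1 := by
      omega
    · have h3 := hH a (by omega)
      rw [cycSucc_of_lt (by omega)] at h3 ⊢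
      clear hH
      grind
    · have h3 := hH a (by omega)
      rw [cycSucc_of_lt (by omega)]
      clear hH
      unfold cycSucc at h3
      grind
    · have h3 := hH (c - 1) (by omega)
      rw [cycSucc_of_lt (by omega)]
      clear hH
      unfold cycSucc at h3
      grind
    · have h3 := hH (a - 2) (by omega)
      rw [cycSucc_of_lt (by omega)] at h3 ⊢
      clear hH
      grind
    · have h3 := hH (n - 1) (by omega)
      rw [cycSucc_of_eq (by omega)] at h3 ⊢
      clear hH
      grind
  · intro b hb
    clear hH h1 h2 he hf hce hcf hj
    obtain h | h | h | h | h | h | h | h : b + 1 < c ∨ b + 1 = c ∨ b = c ∨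
        c + 1 ≤ b ∧ b + 1 < c + n + 2 ∨ b + 1 = c + n + 2 ∨ b = c + n + 2 ∨
        c + n + 3 ≤ b ∧ b < 2 * n + 3 ∨ b = 2 * n + 3 := by
      omega
    · have h3 := hQ b (by omega)
      rw [cycSucc_of_lt (by omega)] at h3 ⊢
      clear hQ
      grind
    · have h3 : y b ≤ 1 := by have := hQ b (by omega); omega
      rw [cycSucc_of_lt (by omega)]
      clear hQ
      grind
    · have h3 := hQ (c - 1) (by omega)
      rw [cycSucc_of_lt (by omega)] at h3 ⊢
      clear hQ
      grind
    · have h3 := hQ (b - 2) (by omega)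
      rw [cycSucc_of_lt (by omega)] at h3 ⊢
      clear hQ
      grind
    · have h3 := hQ (b - 2) (by omega)
      rw [cycSucc_of_lt (by omega)]
      clear hQ
      grind
    · have h3 : y (c + n - 1) ≤ 1 := by have := hQ (c + n - 1) (by omega); omega
      subst h
      rw [cycSucc_of_lt (by omega)]
      clear hQ
      grind
    · obtain ⟨d, rfl⟩ : ∃ d, b = d + 4 := ⟨b - 4, by omega⟩
      have h3 := hQ d (by omega)
      have h4 : d + 4 + 1 = (if w < c then w else if w < c + n then w + 2 else w + 4) ↔
          d + 1 = w := by
        split_ifs <;> omega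
      rw [cycSucc_of_lt (by omega)] at h3 ⊢
      simp only [h4]
      clear hQ
      grind
    · have h3 := hQ (2 * n - 1) (by omega)
      rw [cycSucc_of_eq (by omega)] at h3 ⊢
      clear hQ
      grind
  · grind
  · clear hH hQ h1 h2 hf hcf hj hw
    cases e <;> simp only [BEdge.collapse, Avoids, val] at * <;> grind
  · clear hH hQ h1 h2 he hce hj hw
    cases f <;> simp only [BEdge.collapse, Avoids, val] at * <;> grind
  · clear hH hQ he hf hce hcf h2
    grind
  · clear hH hQ he hf hce hcf
    unfold cycSucc at *
    grind

/-- Near perfect matchings of `B_5` missing neither `q_0` nor `q_1`: the indicator functions of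
the three kinds of edges as bit masks, and the index of the missed vertex. -/
def matchingsFive : List (ℕ × ℕ × ℕ × ℕ) :=
  [(5, 165, 16, 9), (18, 337, 8, 2), (16, 552, 262, 7), (8, 266, 193, 5), (4, 84, 515, 8),
   (2, 642, 56, 6), (0, 5, 992, 4), (9, 329, 4, 5), (20, 658, 64, 3), (0, 160, 527, 4),
   (1, 546, 400, 3), (2, 74, 769, 5), (8, 584, 38, 8), (4, 292, 19, 7), (16, 532, 386, 6),
   (10, 170, 1, 9), (0, 257, 124, 7), (1, 81, 524, 8), (9, 277, 128, 6), (2, 69, 304, 9),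
   (4, 137, 608, 2), (1, 289, 152, 2)]

/-- The indicator function of a bit mask. -/
def bitInd (m a : ℕ) : ℕ := m / 2 ^ a % 2

/-- The edges of `B_5`. -/
def edgesFive : List BEdge :=
  (List.range 5).map hh ++ (List.range 10).map qq ++ (List.range 10).map sp

lemma isNearPerfect_of_mem_matchingsFive : ∀ t ∈ matchingsFive,
    IsNearPerfect 5 (bitInd t.1) (bitInd t.2.1) (bitInd t.2.2.1) t.2.2.2 ∧
      t.2.2.2 ≠ 0 ∧ t.2.2.2 ≠ 1 := by
  decide +kernel

lemma exists_mem_matchingsFive : ∀ e ∈ edgesFive, ∀ f ∈ edgesFive, e.Disj 5 f →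
    ∃ t ∈ matchingsFive, e.val (bitInd t.1) (bitInd t.2.1) (bitInd t.2.2.1) = 1 ∧
      f.val (bitInd t.1) (bitInd t.2.1) (bitInd t.2.2.1) = 1 := by
  decide +kernel

lemma mem_edgesFive {e : BEdge} (he : e.pos < e.size 5) : e ∈ edgesFive := by
  cases e <;> simpa [edgesFive, pos, size] using he

lemma extends_five {e f : BEdge} {j : ℕ} (he : e.pos < e.size 5) (hf : f.pos < f.size 5)
    (hj : j < 10) (hd : e.Disj 5 f) : Extends 5 e f j := by
  refine extends_of_eq_zero (by norm_num) (fun e f he hf hd => ?_) (10 - j) e f j he hf hj hd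
    (by omega)
  obtain ⟨t, ht, h1, h2⟩ := exists_mem_matchingsFive e (mem_edgesFive he) f (mem_edgesFive hf) hd
  obtain ⟨h3, h4, h5⟩ := isNearPerfect_of_mem_matchingsFive t ht
  exact ⟨_, _, _, _, h3, h1, h2, h4, h5⟩

/-- Any two disjoint edges of `B_n`, for odd `n ≥ 5`, lie in a near perfect matching that misses
a vertex of `Q` other than `q_j` and `q_{j+1}`. -/
lemma extends_of_disj (k : ℕ) {e f : BEdge} {j : ℕ} (he : e.pos < e.size (2 * k + 5))
    (hf : f.pos < f.size (2 * k + 5)) (hj : j < 2 * (2 * k + 5)) (hd : e.Disj (2 * k + 5) f) :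
    Extends (2 * k + 5) e f j := by
  induction k generalizing e f j with
  | zero => exact extends_five he hf hj hd
  | succ k ih =>
    refine extends_of_pos_eq_zero (by omega) (fun e f j he hf hj hd => ?_)
      (e.size (2 * (k + 1) + 5) - e.pos) e f j he hf hj hd (by omega)
    have hn : 2 * (k + 1) + 5 = 2 * k + 5 + 2 := by ring
    rw [hn] at hf hj hd ⊢
    have he' : e.pos < e.size (2 * k + 5 + 2) := by cases e <;> simp only [pos, size] at * <;> omega
    have key : ∀ c, 0 < c → c ≤ 2 * k + 5 → e.Avoids (2 * k + 5 + 2) c →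
        f.Avoids (2 * k + 5 + 2) c → Extends (2 * k + 5 + 2) e f j := fun c hc hck hce hcf =>
      .of_collapse hc hck hj hce hcf <| ih (pos_collapse_lt hc hck he' hce)
        (pos_collapse_lt hc hck hf hcf) (by grind) (hd.collapse hc hck he' hf hce hcf)
    have he2 : e.Avoids (2 * k + 5 + 2) 2 := by
      cases e <;> simp only [pos, Avoids] at * <;> omega
    have he5 : e.Avoids (2 * k + 5 + 2) 5 := by
      cases e <;> simp only [pos, Avoids] at * <;> omega
    have hff : f.Avoids (2 * k + 5 + 2) 2 ∨ f.Avoids (2 * k + 5 + 2) 5 := by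
      cases f <;> simp only [pos, size, Avoids] at * <;> omega
    rcases hff with hff | hff
    · exact key 2 (by omega) (by omega) he2 hff
    · exact key 5 (by omega) (by omega) he5 hff

lemma exists_cycSucc_eq {n v : ℕ} (hv : v < n) : ∃ a < n, cycSucc n a = v := by
  refine ⟨if v = 0 then n - 1 else v - 1, ?_, ?_⟩
  · split <;> omega
  · unfold cycSucc
    split_ifs <;> omega

lemma cycSucc_injective (n : ℕ) : (cycSucc n).Injective := by
  intro a b h
  unfold cycSucc at h
  split_ifs at h <;> omega

namespace IsNearPerfect

variable {n : ℕ} {x y s : ℕ → ℕ} {w : ℕ}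

lemma exists_incH (h : IsNearPerfect n x y s w) {v : ℕ} (hv : v < n) :
    ∃ e : BEdge, e.pos < e.size n ∧ e.val x y s = 1 ∧ e.IncH n v := by
  obtain ⟨a, ha, rfl⟩ := exists_cycSucc_eq hv
  have h1 := h.1 a ha
  obtain h2 | h2 | h2 | h2 : x a = 1 ∨ x (cycSucc n a) = 1 ∨ s (cycSucc n a) = 1 ∨
    s (cycSucc n a + n) = 1 := by omega
  · exact ⟨hh a, ha, h2, .inr rfl⟩
  · exact ⟨hh (cycSucc n a), hv, h2, .inl rfl⟩
  · exact ⟨sp (cycSucc n a), by simp only [pos, size]; omega, h2, .inl rfl⟩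
  · exact ⟨sp (cycSucc n a + n), by simp only [pos, size]; omega, h2, .inr rfl⟩

lemma exists_incQ (h : IsNearPerfect n x y s w) {v : ℕ} (hv : v < 2 * n) (hw : v ≠ w) :
    ∃ e : BEdge, e.pos < e.size n ∧ e.val x y s = 1 ∧ e.IncQ n v := by
  obtain ⟨a, ha, rfl⟩ := exists_cycSucc_eq hv
  have h1 := h.2.1 a ha
  rw [if_neg hw] at h1
  obtain h2 | h2 | h2 : y a = 1 ∨ y (cycSucc (2 * n) a) = 1 ∨ s (cycSucc (2 * n) a) = 1 := by omega
  · exact ⟨qq a, ha, h2, .inr rfl⟩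
  · exact ⟨qq (cycSucc (2 * n) a), hv, h2, .inl rfl⟩
  · exact ⟨sp (cycSucc (2 * n) a), hv, h2, rfl⟩

lemma eq_of_incH (h : IsNearPerfect n x y s w) {v : ℕ} (hv : v < n) {e f : BEdge}
    (he1 : e.val x y s = 1) (hf1 : f.val x y s = 1) (hev : e.IncH n v) (hfv : f.IncH n v) : e = f := by
  obtain ⟨a, ha, rfl⟩ := exists_cycSucc_eq hv
  have h1 := h.1 a ha
  have key : ∀ e : BEdge, e.IncH n (cycSucc n a) → e = hh a ∨
      e = hh (cycSucc n a) ∨ e = sp (cycSucc n a) ∨ e = sp (cycSucc n a + n) := by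
    rintro (b | b | b) (hi | hi)
    · simp [hi]
    · exact .inl (congrArg hh (cycSucc_injective n hi).symm)
    · simp [hi]
    · simp [hi]
  rcases key e hev with rfl | rfl | rfl | rfl <;>
    rcases key f hfv with rfl | rfl | rfl | rfl <;>
    first | rfl | (simp only [val] at he1 hf1; omega)

lemma eq_or_eq_or_eq_of_incQ {a : ℕ} {e : BEdge} (hi : e.IncQ n (cycSucc (2 * n) a)) :
    e = qq a ∨ e = qq (cycSucc (2 * n) a) ∨ e = sp (cycSucc (2 * n) a) := by
  rcases e with b | b | b
  · exact hi.elim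
  · rcases hi with hi | hi
    · simp [hi]
    · exact .inl (congrArg qq (cycSucc_injective _ hi).symm)
  · exact .inr (.inr (congrArg sp (Eq.symm hi)))

lemma eq_of_incQ (h : IsNearPerfect n x y s w) {v : ℕ} (hv : v < 2 * n) {e f : BEdge}
    (he1 : e.val x y s = 1) (hf1 : f.val x y s = 1) (hev : e.IncQ n v) (hfv : f.IncQ n v) : e = f := by
  obtain ⟨a, ha, rfl⟩ := exists_cycSucc_eq hv
  have h1 := h.2.1 a ha
  rcases eq_or_eq_or_eq_of_incQ hev with rfl | rfl | rfl <;>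
    rcases eq_or_eq_or_eq_of_incQ hfv with rfl | rfl | rfl <;>
    first | rfl | (simp only [val] at he1 hf1; omega)

lemma not_incQ (h : IsNearPerfect n x y s w) {e : BEdge} (he1 : e.val x y s = 1) : ¬ e.IncQ n w := by
  intro hev
  obtain ⟨a, ha, rfl⟩ := exists_cycSucc_eq h.2.2
  have h1 := h.2.1 a ha
  rw [if_pos rfl] at h1
  rcases eq_or_eq_or_eq_of_incQ hev with rfl | rfl | rfl <;> simp only [val] at he1 <;> omega

end IsNearPerfect

lemma natCast_cycSucc (n a : ℕ) : (cycSucc n a : ZMod n) = a + 1 := by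
  unfold cycSucc
  split_ifs with h
  · rw [← Nat.cast_succ, Nat.succ_eq_add_one, h, ZMod.natCast_self, Nat.cast_zero]
  · exact Nat.cast_succ a

lemma ZMod.eq_natCast_iff_val_eq {n : ℕ} [NeZero n] {a : ℕ} (ha : a < n) (z : ZMod n) :
    z = a ↔ z.val = a := by
  constructor
  · rintro rfl
    exact ZMod.val_cast_of_lt ha
  · rintro rfl
    exact (ZMod.natCast_rightInverse z).symm

lemma ZMod.eq_natCast_add_one_iff {n : ℕ} [NeZero n] {a : ℕ} (ha : a < n) (z : ZMod n) :
    z = a + 1 ↔ z.val = cycSucc n a := by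
  rw [← natCast_cycSucc, ZMod.eq_natCast_iff_val_eq (cycSucc_lt ha)]

namespace BEdge

/-- The edge of `B_n` with the given name. -/
def toSym2 (n : ℕ) : BEdge → Sym2 (ZMod n ⊕ ZMod (2 * n))
  | hh a => s(Sum.inl a, Sum.inl (a + 1))
  | qq b => s(Sum.inr b, Sum.inr (b + 1))
  | sp b => s(Sum.inl b, Sum.inr b)

lemma toSym2_mem_edgeSet {n : ℕ} (hn : 1 < n) {e : BEdge} (he : e.pos < e.size n) :
    e.toSym2 n ∈ (Bgraph n).edgeSet := by
  have : Fact (1 < n) := ⟨hn⟩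
  have : Fact (1 < 2 * n) := ⟨by omega⟩
  rcases e with a | b | b
  · simp [toSym2, Bgraph, bRel]
  · simp [toSym2, Bgraph, bRel]
  · simp [toSym2, Bgraph, bRel, ZMod.val_cast_of_lt (show b < 2 * n from he)]

variable {n : ℕ} [NeZero n] {e : BEdge}

lemma inl_mem_toSym2 (he : e.pos < e.size n) (z : ZMod n) :
    Sum.inl z ∈ e.toSym2 n ↔ e.IncH n z.val := by
  rcases e with a | b | b
  · replace he : a < n := he
    simp [toSym2, IncH, ZMod.eq_natCast_iff_val_eq he, ZMod.eq_natCast_add_one_iff he]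
  · simp [toSym2, IncH]
  · simp only [toSym2, IncH, Sym2.mem_iff, Sum.inl.injEq, reduceCtorEq, or_false]
    have hz := z.val_lt
    simp only [pos, size] at he
    by_cases hb : b < n
    · rw [ZMod.eq_natCast_iff_val_eq hb]
      omega
    · obtain ⟨d, rfl⟩ := Nat.exists_eq_add_of_le (not_lt.1 hb)
      rw [Nat.cast_add, ZMod.natCast_self, zero_add, ZMod.eq_natCast_iff_val_eq (by omega)]
      omega

lemma inr_mem_toSym2 (he : e.pos < e.size n) (z : ZMod (2 * n)) :
    Sum.inr z ∈ e.toSym2 n ↔ e.IncQ n z.val := by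
  rcases e with a | b | b
  · simp [toSym2, IncQ]
  · replace he : b < 2 * n := he
    simp [toSym2, IncQ, ZMod.eq_natCast_iff_val_eq he, ZMod.eq_natCast_add_one_iff he]
  · replace he : b < 2 * n := he
    simp [toSym2, IncQ, ZMod.eq_natCast_iff_val_eq he]

lemma exists_toSym2_eq {p : Sym2 (ZMod n ⊕ ZMod (2 * n))} (hp : p ∈ (Bgraph n).edgeSet) :
    ∃ e : BEdge, e.pos < e.size n ∧ e.toSym2 n = p := by
  have key : ∀ u v, bRel n u v → ∃ e : BEdge, e.pos < e.size n ∧ e.toSym2 n = s(u, v) := by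
    rintro (a | a) (b | b) h
    · obtain rfl : b = a + 1 := h
      exact ⟨hh a.val, a.val_lt, by simp [toSym2]⟩
    · obtain rfl : a = (b.val : ZMod n) := h
      exact ⟨sp b.val, b.val_lt, by simp [toSym2]⟩
    · exact h.elim
    · obtain rfl : b = a + 1 := h
      exact ⟨qq a.val, a.val_lt, by simp [toSym2]⟩
  induction p using Sym2.ind with
  | _ u v =>
    rcases hp.2 with h | h
    · exact key u v h
    · rw [Sym2.eq_swap]
      exact key v u h

end BEdge

/-- for odd `n ≥ 5` and any edge `e₀ = q_j q_{j+1}` of the cycle induced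
by `Q`, every 2-matching of `B_n` extends to a near perfect matching of `B_n`
(a matching covering all vertices except exactly one), which in particular covers
every vertex of `H` and both ends of `e₀`. -/
theorem Bgraph_two_matching_extends_to_near_perfect (n : ℕ) (hn : 5 ≤ n) (hno : Odd n)
    (j : ZMod (2 * n))
    (M : Set (Sym2 (ZMod n ⊕ ZMod (2 * n))))
    (hM : IsMatchingSet (Bgraph n) M) (hM2 : M.ncard = 2) :
    ∃ M', IsMatchingSet (Bgraph n) M' ∧ M ⊆ M' ∧
      ∃ w : ZMod n ⊕ ZMod (2 * n),
        (¬ ∃ e ∈ M', w ∈ e) ∧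
        (∀ v : ZMod n ⊕ ZMod (2 * n), v ≠ w → ∃ e ∈ M', v ∈ e) ∧
        (∀ a : ZMod n, w ≠ Sum.inl a) ∧
        w ≠ Sum.inr j ∧ w ≠ Sum.inr (j + 1) := by
  obtain ⟨k, hk⟩ : ∃ k, n = 2 * k + 5 := by
    obtain ⟨m, rfl⟩ := hno
    exact ⟨m - 2, by omega⟩
  have hext := @extends_of_disj k
  rw [← hk] at hext
  have : NeZero n := ⟨by omega⟩
  obtain ⟨p, q, hpq, rfl⟩ := Set.ncard_eq_two.1 hM2
  obtain ⟨hMG, hMd⟩ := hM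
  obtain ⟨e, he, rfl⟩ := exists_toSym2_eq (hMG (Set.mem_insert p {q}))
  obtain ⟨f, hf, rfl⟩ := exists_toSym2_eq (hMG (Set.mem_insert_of_mem _ (Set.mem_singleton q)))
  have hd := hMd (by simp) (by simp) hpq
  have hdisj : e.Disj n f := by
    constructor
    · rintro v hv ⟨h1, h2⟩
      rw [← ZMod.val_cast_of_lt hv] at h1 h2
      exact hd _ ((inl_mem_toSym2 he _).2 h1) ((inl_mem_toSym2 hf _).2 h2)
    · rintro v hv ⟨h1, h2⟩
      rw [← ZMod.val_cast_of_lt hv] at h1 h2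
      exact hd _ ((inr_mem_toSym2 he _).2 h1) ((inr_mem_toSym2 hf _).2 h2)
  obtain ⟨x, y, s, w, h, he1, hf1, hwj, hwj'⟩ := hext he hf j.val_lt hdisj
  refine ⟨{p | ∃ c : BEdge, c.pos < c.size n ∧ c.val x y s = 1 ∧ c.toSym2 n = p}, ⟨?_, ?_⟩, ?_,
    Sum.inr (w : ZMod (2 * n)), ?_, ?_, ?_, ?_, ?_⟩
  · rintro _ ⟨c, hc, -, rfl⟩
    exact toSym2_mem_edgeSet (by omega) hc
  · rintro _ ⟨c, hc, hc1, rfl⟩ _ ⟨d, hd, hd1, rfl⟩ hne (z | z) hzc hzd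
    · rw [inl_mem_toSym2 hc] at hzc
      rw [inl_mem_toSym2 hd] at hzd
      exact hne (congrArg _ (h.eq_of_incH z.val_lt hc1 hd1 hzc hzd))
    · rw [inr_mem_toSym2 hc] at hzc
      rw [inr_mem_toSym2 hd] at hzd
      exact hne (congrArg _ (h.eq_of_incQ z.val_lt hc1 hd1 hzc hzd))
  · rintro _ (rfl | rfl)
    · exact ⟨e, he, he1, rfl⟩
    · exact ⟨f, hf, hf1, rfl⟩
  · rintro ⟨_, ⟨c, hc, hc1, rfl⟩, hwc⟩
    rw [inr_mem_toSym2 hc, ZMod.val_cast_of_lt h.2.2] at hwc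
    exact h.not_incQ hc1 hwc
  · rintro (z | z) hz
    · obtain ⟨c, hc, hc1, hcz⟩ := h.exists_incH z.val_lt
      exact ⟨_, ⟨c, hc, hc1, rfl⟩, (inl_mem_toSym2 hc z).2 hcz⟩
    · have hzw : z.val ≠ w := fun hzw =>
        hz (congrArg _ ((ZMod.eq_natCast_iff_val_eq h.2.2 z).2 hzw))
      obtain ⟨c, hc, hc1, hcz⟩ := h.exists_incQ z.val_lt hzw
      exact ⟨_, ⟨c, hc, hc1, rfl⟩, (inr_mem_toSym2 hc z).2 hcz⟩
  · simp
  · intro hw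
    exact hwj ((ZMod.eq_natCast_iff_val_eq h.2.2 j).1 (Sum.inr_injective hw).symm).symm
  · intro hw
    have := Sum.inr_injective hw
    rw [← ZMod.natCast_rightInverse j] at this
    rw [ZMod.eq_natCast_add_one_iff j.val_lt, ZMod.val_cast_of_lt h.2.2] at this
    exact hwj' this
end

section
/- Let k ≥ 2 and let G be a connected k-extendable graph of order 2k+2 whose connectivity is at least 2k (i.e., G has more than 2k vertices and remains connected after deleting any set of fewer than 2k vertices, or G is complete). Then G is the complete graph K_{2k+2}. -/
open SimpleGraph

/-- `G` has (vertex) connectivity at least `c`: it is a complete graph on more than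
`c` vertices, or it has more than `c` vertices and the deletion of any set of fewer
than `c` vertices leaves a connected graph. -/
def ConnAtLeast {V : Type*} [Fintype V] (G : SimpleGraph V) (c : ℕ) : Prop :=
  (c < Fintype.card V ∧ G = ⊤) ∨
    (c < Fintype.card V ∧ ∀ S : Set V, S.ncard < c → (G.induce Sᶜ).Connected)

/-- `M` is a matching of `G` with `m` edges whose set of covered vertices is exactly `s`. -/
def IsMatchingCovering {V : Type*} (G : SimpleGraph V) (s : Finset V) (m : ℕ)
    (M : Set (Sym2 V)) : Prop :=
  IsMatchingSet G M ∧ M.Finite ∧ M.ncard = m ∧ ∀ v, v ∈ s ↔ ∃ e ∈ M, v ∈ e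

lemma isMatchingCovering_empty {V : Type*} (G : SimpleGraph V) :
    IsMatchingCovering G ∅ 0 ∅ := by
  simp [IsMatchingCovering, IsMatchingSet]

lemma IsMatchingCovering.insert_edge {V : Type*} [DecidableEq V] {G : SimpleGraph V}
    {s : Finset V} {m : ℕ} {M : Set (Sym2 V)} (hM : IsMatchingCovering G s m M) {v w : V}
    (hvw : G.Adj v w) (hv : v ∉ s) (hw : w ∉ s) :
    IsMatchingCovering G (insert v (insert w s)) (m + 1) (insert s(v, w) M) := by
  obtain ⟨⟨hsub, hpair⟩, hfin, hcard, hcover⟩ := hM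
  have hvM : ∀ e ∈ M, v ∉ e := fun e he h => hv ((hcover v).2 ⟨e, he, h⟩)
  have hwM : ∀ e ∈ M, w ∉ e := fun e he h => hw ((hcover w).2 ⟨e, he, h⟩)
  refine ⟨⟨Set.insert_subset hvw hsub, ?_⟩, hfin.insert _, ?_, fun x => ?_⟩
  · refine hpair.insert fun e he _ => ⟨fun x hx => ?_, fun x hxe hx => ?_⟩
    · rcases Sym2.mem_iff.1 hx with rfl | rfl
      exacts [hvM e he, hwM e he]
    · rcases Sym2.mem_iff.1 hx with rfl | rfl
      exacts [hvM e he hxe, hwM e he hxe]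
  · rw [Set.ncard_insert_of_notMem (fun h => hvM _ h (Sym2.mem_mk_left v w)) hfin, hcard]
  · simp [hcover, or_assoc]

lemma exists_isMatchingCovering {V : Type*} [DecidableEq V] {G : SimpleGraph V}
    (hG : ∀ v a b : V, a ≠ v → b ≠ v → a ≠ b → G.Adj v a ∨ G.Adj v b) (m : ℕ) :
    ∀ s : Finset V, s.card = 2 * (m + 2) → ∃ M, IsMatchingCovering G s (m + 2) M := by
  induction m with
  | zero =>
    intro s hs
    obtain ⟨a, b, c, d, hab, hac, had, hbc, hbd, hcd, rfl⟩ := Finset.card_eq_four.1 hs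
    by_cases h : G.Adj a b ∧ G.Adj c d
    · exact ⟨_, ((isMatchingCovering_empty G).insert_edge h.2 (by simp)
        (by simp)).insert_edge h.1 (by simp [*]) (by simp [*])⟩
    · have h1 : G.Adj a c ∧ G.Adj b d := by
        have := hG a b c hab.symm hac.symm hbc
        have := hG b a d hab hbd.symm had
        have := hG c d a hcd.symm hac had.symm
        have := hG d c b hcd hbd hbc.symm
        simp only [G.adj_comm b a, G.adj_comm c a, G.adj_comm d b, G.adj_comm d c] at *
        tauto
      have h2 := ((isMatchingCovering_empty G).insert_edge h1.2 (by simp)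
        (by simp)).insert_edge h1.1 (by simp [*]) (by simp [hbc.symm, hcd])
      rw [Finset.insert_comm c b] at h2
      exact ⟨_, h2⟩
  | succ m ih =>
    intro s hs
    obtain ⟨v, hv, x, hx, y, hy, hvx, hvy, hxy⟩ := Finset.two_lt_card.1 (by omega : 2 < s.card)
    obtain ⟨w, hw, hvw⟩ : ∃ w ∈ s, G.Adj v w :=
      (hG v x y hvx.symm hvy.symm hxy).elim (⟨x, hx, ·⟩) (⟨y, hy, ·⟩)
    have hv' : v ∈ s.erase w := Finset.mem_erase.2 ⟨hvw.ne, hv⟩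
    obtain ⟨M, hM⟩ := ih ((s.erase w).erase v) (by
      rw [Finset.card_erase_of_mem hv', Finset.card_erase_of_mem hw]; omega)
    have h := hM.insert_edge hvw (by simp) (by simp)
    rw [Finset.insert_comm, Finset.insert_erase hv', Finset.insert_erase hw] at h
    exact ⟨_, h⟩

/-- Deleting all vertices but three leaves a connected graph, so no vertex has two
non-neighbours. -/
lemma adj_or_adj_of_connected_induce {V : Type*} [Fintype V] {G : SimpleGraph V} {c : ℕ}
    (hcard : Fintype.card V = c + 2)
    (hG : ∀ S : Set V, S.ncard < c → (G.induce Sᶜ).Connected)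
    (v a b : V) (hav : a ≠ v) (hbv : b ≠ v) (hab : a ≠ b) : G.Adj v a ∨ G.Adj v b := by
  have h3 : ({v, a, b} : Set V).ncard = 3 :=
    Set.ncard_eq_three.2 ⟨v, a, b, hav.symm, hbv.symm, hab, rfl⟩
  have h := hG {v, a, b}ᶜ (by
    have := Set.ncard_add_ncard_compl ({v, a, b} : Set V)
    rw [Nat.card_eq_fintype_card] at this
    omega)
  rw [compl_compl] at h
  have : Nontrivial ({v, a, b} : Set V) :=
    ⟨⟨v, by simp⟩, ⟨a, by simp⟩, fun h => hav (congrArg Subtype.val h).symm⟩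
  obtain ⟨⟨w, hw⟩, hvw⟩ := h.preconnected.exists_adj_of_nontrivial ⟨v, by simp⟩
  have hvw : G.Adj v w := hvw
  rcases hw with rfl | rfl | rfl
  · exact absurd hvw (G.loopless.irrefl _)
  · exact .inl hvw
  · exact .inr hvw

/-- for `k ≥ 2`, a connected `k`-extendable graph of order `2k + 2`
with connectivity at least `2k` is the complete graph `K_{2k+2}`. -/
theorem extendable_high_connectivity_is_complete {V : Type*} [Fintype V]
    (G : SimpleGraph V) (k : ℕ) (hk : 2 ≤ k)
    (hconn : G.Connected) (hext : Extendable G k) (hcard : Fintype.card V = 2 * k + 2)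
    (hkappa : ConnAtLeast G (2 * k)) : G = ⊤ := by
  classical
  obtain ⟨-, h⟩ | ⟨-, hdel⟩ := hkappa
  · exact h
  by_contra hne
  obtain ⟨a, b, hab, hnadj⟩ := SimpleGraph.ne_top_iff_exists_not_adj.1 hne
  obtain ⟨m, rfl⟩ := Nat.exists_eq_add_of_le' hk
  obtain ⟨M, hM, -, hMcard, hcover⟩ := exists_isMatchingCovering
    (adj_or_adj_of_connected_induce hcard hdel) m ({a, b} : Finset V)ᶜ (by
      rw [Finset.card_compl, Finset.card_pair hab, hcard]; omega)
  obtain ⟨P, ⟨⟨hPsub, hPpair⟩, hPcover⟩, hMP⟩ := hext.2 M hM hMcard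
  obtain ⟨e, he, hae⟩ := hPcover a
  obtain ⟨c, rfl⟩ := hae
  have hac : G.Adj a c := hPsub he
  have hcb : c ≠ b := by rintro rfl; exact hnadj hac
  obtain ⟨f, hf, hcf⟩ := (hcover c).1 (by simp [hac.ne', hcb])
  have haf : a ∉ f := fun h => by simpa using (hcover a).2 ⟨f, hf, h⟩
  exact hPpair he (hMP hf) (fun h => haf (h ▸ Sym2.mem_mk_left a c)) c
    (Sym2.mem_mk_right a c) hcf
end
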